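/- Let f : U → 𝔸¹ be a non-constant regular map on a smooth complex affine variety U. Then there exists R > 0 such that the restriction f : U \ f^{-1}(D̄(0,R)) → ℂ \ D̄(0,R) is a locally trivial topological fibration, where D̄(0,R) is the closed disk of radius R. In particular, all fibers f^{-1}(t) for |t| > R are homeomorphic. -/

import Mathlib

open Finset MvPolynomial

noncomputable section

/-- The gradient of the polynomial `p` at `x ∈ ℂ^N`. -/
def gradAt {N : ℕ} (p : MvPolynomial (Fin N) ℂ) (x : Fin N → ℂ) : Fin N → ℂ :=
  fun i => eval x (pderiv i p)

namespace FibInf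

section Interpolation
open Filter Topology

lemma eq_of_norm_sub_le {ι : Type*} {a δ : ι → ℂ} {ε : ℝ} (hδ : ∀ i j, ‖δ i - δ j‖ ≤ ε * ‖a i - a j‖)
    (i j : ι) (h : a i = a j) : δ i = δ j := by
  have := hδ i j
  rw [h, sub_self, norm_zero, mul_zero] at this
  exact sub_eq_zero.1 (norm_le_zero_iff.1 this)

variable {ι : Type*} [Fintype ι]

open Classical in
/-- Weights of the inverse-distance interpolation at the nodes `a`. -/
def weight (a : ι → ℂ) (w : ℂ) (j : ι) : ℂ :=
  if h : ∃ i, w = a i then (if j = h.choose then 1 else 0)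
  else ((‖w - a j‖⁻¹ / ∑ k, ‖w - a k‖⁻¹ : ℝ) : ℂ)

/-- Inverse-distance interpolation of the values `δ` at the nodes `a`. -/
def interp (a δ : ι → ℂ) (w : ℂ) : ℂ := ∑ j, weight a w j * δ j

lemma interp_node {a δ : ι → ℂ} (hδ : ∀ i j, a i = a j → δ i = δ j) (i : ι) :
    interp a δ (a i) = δ i := by
  classical
  have h : ∃ k, a i = a k := ⟨i, rfl⟩
  have : interp a δ (a i) = δ h.choose := by
    simp [interp, weight, h]
  rw [this]
  exact (hδ _ _ h.choose_spec).symm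

lemma interp_eq {a δ : ι → ℂ} {w : ℂ} (h : ∀ i, w ≠ a i) :
    interp a δ w = (∑ j, ((‖w - a j‖⁻¹ : ℝ) : ℂ) * δ j) / ((∑ k, ‖w - a k‖⁻¹ : ℝ) : ℂ) := by
  have h' : ¬ ∃ i, w = a i := by simpa using h
  simp only [interp, weight, h', dif_neg, not_false_iff, Finset.sum_div]
  refine Finset.sum_congr rfl fun j _ => ?_
  push_cast
  ring

lemma sum_inv_pos {a : ι → ℂ} {w : ℂ} (h : ∀ i, w ≠ a i) (i : ι) :
    0 < ∑ k, ‖w - a k‖⁻¹ :=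
  Finset.sum_pos (fun k _ => inv_pos.2 (norm_pos_iff.2 (sub_ne_zero.2 (h k)))) ⟨i, mem_univ _⟩

lemma norm_interp_sub_le {a δ : ι → ℂ} {ε : ℝ} (hε : 0 ≤ ε)
    (hδ : ∀ i j, ‖δ i - δ j‖ ≤ ε * ‖a i - a j‖) (w : ℂ) (i : ι) :
    ‖interp a δ w - δ i‖ ≤ ε * (Fintype.card ι + 1) * ‖w - a i‖ := by
  have hδ' := eq_of_norm_sub_le hδ
  by_cases h : ∃ k, w = a k
  · obtain ⟨k, rfl⟩ := h
    rw [interp_node hδ']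
    refine (hδ _ _).trans ?_
    gcongr
    nlinarith [show (0 : ℝ) ≤ Fintype.card ι by positivity]
  · push Not at h
    have hS := sum_inv_pos h i
    set S := ∑ k, ‖w - a k‖⁻¹ with hSdef
    have hr : ∀ k, 0 < ‖w - a k‖ := fun k => norm_pos_iff.2 (sub_ne_zero.2 (h k))
    have hSC : (S : ℂ) ≠ 0 := by exact_mod_cast hS.ne'
    have e1 : interp a δ w - δ i = (∑ j, ((‖w - a j‖⁻¹ : ℝ) : ℂ) * (δ j - δ i)) / (S : ℂ) := by
      rw [interp_eq h, ← hSdef, eq_div_iff hSC, sub_mul, div_mul_cancel₀ _ hSC]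
      simp only [mul_sub, Finset.sum_sub_distrib, ← Finset.sum_mul]
      rw [hSdef]; push_cast; ring
    rw [e1, norm_div, Complex.norm_real, Real.norm_of_nonneg hS.le, div_le_iff₀ hS]
    calc ‖∑ j, ((‖w - a j‖⁻¹ : ℝ) : ℂ) * (δ j - δ i)‖
        ≤ ∑ j, ‖w - a j‖⁻¹ * (ε * (‖w - a j‖ + ‖w - a i‖)) := by
          refine norm_sum_le_of_le _ fun j _ => ?_
          rw [norm_mul, Complex.norm_real, Real.norm_of_nonneg (inv_pos.2 (hr j)).le]
          have := hr j
          gcongr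
          refine (hδ j i).trans ?_
          gcongr
          rw [← norm_sub_rev (a j) w]
          exact (norm_sub_le_norm_sub_add_norm_sub _ w _)
      _ = ε * (Fintype.card ι + S * ‖w - a i‖) := by
          rw [hSdef, Finset.sum_mul, ← Finset.card_univ, Finset.cast_card, ← Finset.sum_add_distrib,
            Finset.mul_sum]
          refine Finset.sum_congr rfl fun j _ => ?_
          have := (hr j).ne'
          field_simp
      _ ≤ ε * (Fintype.card ι + 1) * ‖w - a i‖ * S := by
          have h1 : 1 ≤ ‖w - a i‖ * S := by
            rw [← mul_inv_cancel₀ (hr i).ne']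
            gcongr
            exact Finset.single_le_sum (f := fun k => ‖w - a k‖⁻¹)
                (fun k _ => (inv_pos.2 (hr k)).le) (mem_univ i)
          have h2 : (0 : ℝ) ≤ Fintype.card ι := by positivity
          have h3 : (Fintype.card ι : ℝ) ≤ Fintype.card ι * (‖w - a i‖ * S) := le_mul_of_one_le_right h2 h1
          calc ε * (Fintype.card ι + S * ‖w - a i‖)
              ≤ ε * (Fintype.card ι * (‖w - a i‖ * S) + S * ‖w - a i‖) := by gcongr
            _ = _ := by ring

/-- The cross terms in the difference of two normalised weighted sums. -/
lemma two_mul_div_sub_div (s s' : ι → ℝ) (δ : ι → ℂ) (hS : ∑ k, s k ≠ 0) (hS' : ∑ k, s' k ≠ 0) :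
    2 * ((∑ j, (s j : ℂ) * δ j) / ((∑ k, s k : ℝ) : ℂ) -
      (∑ j, (s' j : ℂ) * δ j) / ((∑ k, s' k : ℝ) : ℂ)) =
    (∑ j, ∑ k, ((s j * s' k - s' j * s k : ℝ) : ℂ) * (δ j - δ k)) /
      ((∑ k, s k : ℝ) * (∑ k, s' k : ℝ) : ℂ) := by
  have h1 : ((∑ k, s k : ℝ) : ℂ) ≠ 0 := by exact_mod_cast hS
  have h2 : ((∑ k, s' k : ℝ) : ℂ) ≠ 0 := by exact_mod_cast hS'
  rw [div_sub_div _ _ h1 h2, mul_div_assoc']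
  congr 1
  have e : ∀ u v : ι → ℝ, ∑ j, ∑ k, ((u j * v k : ℝ) : ℂ) * δ j =
      (∑ j, (u j : ℂ) * δ j) * ((∑ k, v k : ℝ) : ℂ) := fun u v => by
    push_cast
    rw [Finset.sum_mul_sum]
    exact Finset.sum_congr rfl fun j _ => Finset.sum_congr rfl fun k _ => by ring
  have e' : ∀ u v : ι → ℝ, ∑ j, ∑ k, ((u j * v k : ℝ) : ℂ) * δ k =
      (∑ j, (v j : ℂ) * δ j) * ((∑ k, u k : ℝ) : ℂ) := fun u v => by
    rw [Finset.sum_comm, ← e v u]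
    exact Finset.sum_congr rfl fun j _ => Finset.sum_congr rfl fun k _ => by push_cast; ring
  have : ∀ j k, ((s j * s' k - s' j * s k : ℝ) : ℂ) * (δ j - δ k) =
      ((s j * s' k : ℝ) : ℂ) * δ j - ((s' j * s k : ℝ) : ℂ) * δ j
      - ((s j * s' k : ℝ) : ℂ) * δ k + ((s' j * s k : ℝ) : ℂ) * δ k := fun j k => by
    push_cast; ring
  simp only [this, Finset.sum_add_distrib, Finset.sum_sub_distrib, e, e']
  ring

lemma norm_interp_sub_interp_le {a δ : ι → ℂ} {ε : ℝ} (hε : 0 ≤ ε)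
    (hδ : ∀ i j, ‖δ i - δ j‖ ≤ ε * ‖a i - a j‖) (w w' : ℂ) :
    ‖interp a δ w - interp a δ w'‖ ≤ ε * (2 * (Fintype.card ι + 1) ^ 2) * ‖w - w'‖ := by
  have hδ' := eq_of_norm_sub_le hδ
  have hd : (0 : ℝ) ≤ Fintype.card ι := by positivity
  by_cases h : ∃ k, w = a k
  · obtain ⟨k, rfl⟩ := h
    rw [interp_node hδ', norm_sub_rev, norm_sub_rev (a k)]
    refine (norm_interp_sub_le hε hδ w' k).trans ?_
    gcongr
    nlinarith
  by_cases h' : ∃ k, w' = a k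
  · obtain ⟨k, rfl⟩ := h'
    rw [interp_node hδ']
    refine (norm_interp_sub_le hε hδ w k).trans ?_
    gcongr
    nlinarith
  push Not at h h'
  cases isEmpty_or_nonempty ι
  · simp only [interp, Finset.univ_eq_empty, Finset.sum_empty, sub_self, norm_zero]
    positivity
  have i : ι := Classical.arbitrary ι
  have hS := sum_inv_pos h i
  have hS' := sum_inv_pos h' i
  have hr : ∀ k, 0 < ‖w - a k‖ := fun k => norm_pos_iff.2 (sub_ne_zero.2 (h k))
  have hr' : ∀ k, 0 < ‖w' - a k‖ := fun k => norm_pos_iff.2 (sub_ne_zero.2 (h' k))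
  have key : ‖2 * (interp a δ w - interp a δ w')‖ ≤ 4 * (Fintype.card ι) ^ 2 * (ε * ‖w - w'‖) := by
    rw [interp_eq h, interp_eq h', two_mul_div_sub_div _ _ _ hS.ne' hS'.ne', norm_div, norm_mul,
      Complex.norm_real, Complex.norm_real, Real.norm_of_nonneg hS.le, Real.norm_of_nonneg hS'.le,
      div_le_iff₀ (mul_pos hS hS')]
    set S := ∑ k, ‖w - a k‖⁻¹
    set S' := ∑ k, ‖w' - a k‖⁻¹
    have hle : ∀ k, ‖w - a k‖⁻¹ ≤ S := fun k => Finset.single_le_sum (f := fun k => ‖w - a k‖⁻¹)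
                (fun k _ => (inv_pos.2 (hr k)).le) (mem_univ k)
    have hle' : ∀ k, ‖w' - a k‖⁻¹ ≤ S' := fun k => Finset.single_le_sum (f := fun k => ‖w' - a k‖⁻¹)
                (fun k _ => (inv_pos.2 (hr' k)).le) (mem_univ k)
    have term : ∀ j k, ‖((‖w - a j‖⁻¹ * ‖w' - a k‖⁻¹ - ‖w' - a j‖⁻¹ * ‖w - a k‖⁻¹ : ℝ) : ℂ) *
        (δ j - δ k)‖ ≤ 4 * (ε * ‖w - w'‖ * (S * S')) := fun j k => by
      rw [norm_mul, Complex.norm_real, Real.norm_eq_abs]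
      have p1 := hr j; have p2 := hr k; have p3 := hr' j; have p4 := hr' k
      have b1 : |‖w' - a j‖ - ‖w - a j‖| ≤ ‖w - w'‖ := by
        rw [norm_sub_rev w w']
        simpa using abs_norm_sub_norm_le (w' - a j) (w - a j)
      have b2 : |‖w' - a k‖ - ‖w - a k‖| ≤ ‖w - w'‖ := by
        rw [norm_sub_rev w w']
        simpa using abs_norm_sub_norm_le (w' - a k) (w - a k)
      have b3 : ‖a j - a k‖ ≤ ‖w' - a j‖ + ‖w' - a k‖ := by
        rw [← norm_sub_rev (a j) w']
        exact (norm_sub_le_norm_sub_add_norm_sub _ w' _)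
      have l1 := hle j; have l2 := hle k; have l3 := hle' j; have l4 := hle' k
      have n1 : |‖w' - a j‖ * ‖w - a k‖ - ‖w - a j‖ * ‖w' - a k‖| ≤
          ‖w - w'‖ * (‖w - a j‖ + ‖w - a k‖) := by
        rw [show ‖w' - a j‖ * ‖w - a k‖ - ‖w - a j‖ * ‖w' - a k‖ =
          (‖w' - a j‖ - ‖w - a j‖) * ‖w - a k‖ - ‖w - a j‖ * (‖w' - a k‖ - ‖w - a k‖) by ring]
        refine (abs_sub _ _).trans ?_
        rw [abs_mul, abs_mul, abs_of_pos p1, abs_of_pos p2]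
        nlinarith [mul_le_mul_of_nonneg_right b1 p2.le, mul_le_mul_of_nonneg_left b2 p1.le]
      have n2 : ‖w - a j‖⁻¹ * ‖w' - a k‖⁻¹ - ‖w' - a j‖⁻¹ * ‖w - a k‖⁻¹ =
          (‖w' - a j‖ * ‖w - a k‖ - ‖w - a j‖ * ‖w' - a k‖) *
          (‖w - a j‖⁻¹ * ‖w' - a k‖⁻¹ * ‖w' - a j‖⁻¹ * ‖w - a k‖⁻¹) := by
        field_simp
      rw [n2, abs_mul, abs_of_pos (a := ‖w - a j‖⁻¹ * _ * _ * _) (by positivity)]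
      calc _ ≤ (‖w - w'‖ * (‖w - a j‖ + ‖w - a k‖)) *
            (‖w - a j‖⁻¹ * ‖w' - a k‖⁻¹ * ‖w' - a j‖⁻¹ * ‖w - a k‖⁻¹) *
            (ε * (‖w' - a j‖ + ‖w' - a k‖)) := by
            gcongr
            exact (hδ j k).trans (by gcongr)
        _ = ε * ‖w - w'‖ * ((‖w - a j‖⁻¹ + ‖w - a k‖⁻¹) * (‖w' - a j‖⁻¹ + ‖w' - a k‖⁻¹)) := by
            field_simp; ring
        _ ≤ ε * ‖w - w'‖ * ((S + S) * (S' + S')) := by gcongr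
        _ = _ := by ring
    refine (norm_sum_le_of_le _ fun j _ => norm_sum_le_of_le _ fun k _ => term j k).trans ?_
    simp only [Finset.sum_const, Finset.card_univ, nsmul_eq_mul]
    exact le_of_eq (by ring)
  rw [norm_mul, Complex.norm_ofNat] at key
  have : ε * (2 * Fintype.card ι ^ 2) * ‖w - w'‖ ≤
      ε * (2 * (Fintype.card ι + 1) ^ 2) * ‖w - w'‖ := by
    gcongr; linarith
  linarith

lemma interp_comp_perm {a δ : ι → ℂ} (hδ : ∀ i j, a i = a j → δ i = δ j) (σ : Equiv.Perm ι)
    (w : ℂ) : interp (a ∘ σ) (δ ∘ σ) w = interp a δ w := by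
  by_cases h : ∃ k, w = a k
  · obtain ⟨k, rfl⟩ := h
    rw [interp_node hδ]
    have := interp_node (a := a ∘ σ) (δ := δ ∘ σ) (fun i j h => hδ _ _ h) (σ.symm k)
    simpa using this
  · push Not at h
    rw [interp_eq h, interp_eq (a := a ∘ σ) (fun i => h (σ i))]
    congr 1
    · exact Equiv.sum_comp σ (fun j => ((‖w - a j‖⁻¹ : ℝ) : ℂ) * δ j)
    · congr 1
      exact Equiv.sum_comp σ (fun j => ‖w - a j‖⁻¹)

lemma tendsto_interp {α : Type*} {l : Filter α} {a δ : α → ι → ℂ} {w : α → ℂ} {a₀ δ₀ : ι → ℂ}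
    {w₀ : ℂ} {ε : ℝ} (hε : 0 ≤ ε) (hδ : ∀ᶠ x in l, ∀ i j, ‖δ x i - δ x j‖ ≤ ε * ‖a x i - a x j‖)
    (hδ₀ : ∀ i j, ‖δ₀ i - δ₀ j‖ ≤ ε * ‖a₀ i - a₀ j‖)
    (ha : ∀ i, Tendsto (fun x => a x i) l (𝓝 (a₀ i)))
    (hd : ∀ i, Tendsto (fun x => δ x i) l (𝓝 (δ₀ i))) (hw : Tendsto w l (𝓝 w₀)) :
    Tendsto (fun x => interp (a x) (δ x) (w x)) l (𝓝 (interp a₀ δ₀ w₀)) := by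
  by_cases h : ∃ k, w₀ = a₀ k
  · obtain ⟨k, rfl⟩ := h
    rw [interp_node (eq_of_norm_sub_le hδ₀)]
    have h1 : Tendsto (fun x => interp (a x) (δ x) (w x) - δ x k) l (𝓝 0) := by
      have h2 : Tendsto (fun x => ε * (Fintype.card ι + 1) * ‖w x - a x k‖) l (𝓝 0) := by
        have := ((hw.sub (ha k)).norm).const_mul (ε * (Fintype.card ι + 1))
        simpa using this
      refine squeeze_zero_norm' ?_ h2
      filter_upwards [hδ] with x hx using norm_interp_sub_le hε hx _ _
    simpa using h1.add (hd k)
  · push Not at h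
    have hne : ∀ i, ‖w₀ - a₀ i‖ ≠ 0 := fun i => (norm_pos_iff.2 (sub_ne_zero.2 (h i))).ne'
    have ev : ∀ᶠ x in l, ∀ i, w x ≠ a x i := by
      rw [eventually_all]
      intro i
      filter_upwards [(hw.sub (ha i)).eventually_ne (sub_ne_zero.2 (h i))] with x hx
        using sub_ne_zero.1 hx
    have hs : ∀ i, Tendsto (fun x => ‖w x - a x i‖⁻¹) l (𝓝 (‖w₀ - a₀ i‖⁻¹)) :=
      fun i => ((hw.sub (ha i)).norm).inv₀ (hne i)
    rw [interp_eq h]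
    refine Tendsto.congr' (f₁ := fun x => (∑ j, ((‖w x - a x j‖⁻¹ : ℝ) : ℂ) * δ x j) /
      ((∑ k, ‖w x - a x k‖⁻¹ : ℝ) : ℂ)) ?_ ?_
    · filter_upwards [ev] with x hx using (interp_eq hx).symm
    · cases isEmpty_or_nonempty ι
      · simpa using tendsto_const_nhds
      have i : ι := Classical.arbitrary ι
      refine Tendsto.div ?_ ?_ (by exact_mod_cast (sum_inv_pos h i).ne')
      · exact tendsto_finsetSum _ fun j _ =>
          ((Complex.continuous_ofReal.tendsto _).comp (hs j)).mul (hd j)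
      · exact (Complex.continuous_ofReal.tendsto _).comp (tendsto_finsetSum _ fun j _ => hs j)

end Interpolation
end FibInf

namespace FibInf

section Shear

variable {R : Type*} [CommRing R] {n : ℕ}

/-- The substitution `X_0 ↦ X_0`, `X_i ↦ X_i + X_0 ^ e i` for `i ≠ 0`. -/
def shear (e : Fin (n + 1) → ℕ) : MvPolynomial (Fin (n + 1)) R →ₐ[R] MvPolynomial (Fin (n + 1)) R :=
  aeval fun i => if i = 0 then X 0 else X i + X 0 ^ e i

/-- The action of `shear` on points. -/
def shearPt {K : Type*} [CommRing K] (e : Fin (n + 1) → ℕ) (x : Fin (n + 1) → K) :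
    Fin (n + 1) → K :=
  fun i => if i = 0 then x 0 else x i + x 0 ^ e i

lemma eval₂_shear {K : Type*} [CommRing K] (φ : R →+* K) (e : Fin (n + 1) → ℕ)
    (x : Fin (n + 1) → K) (p : MvPolynomial (Fin (n + 1)) R) :
    eval₂Hom φ x (shear e p) = eval₂Hom φ (shearPt e x) p := by
  have : (eval₂Hom φ x).comp (shear e : MvPolynomial (Fin (n + 1)) R →ₐ[R] _).toRingHom =
      eval₂Hom φ (shearPt e x) := by
    ext i
    · simp [shear]
    · by_cases h : i = 0 <;> simp [shear, shearPt, h]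
  exact congrArg (fun g => g p) this

lemma finSuccEquiv_shear_X_leadingCoeff [IsDomain R] {e : Fin (n + 1) → ℕ} (he : ∀ i, 0 < e i)
    (j : Fin (n + 1)) : ((finSuccEquiv R n) (shear e (X j))).leadingCoeff = 1 := by
  by_cases h : j = 0
  · simp [h, shear, finSuccEquiv_X_zero]
  · obtain ⟨i, rfl⟩ := Fin.exists_succ_eq.mpr h
    simp [shear, finSuccEquiv_X_succ, finSuccEquiv_X_zero, add_comm,
      Polynomial.leadingCoeff_X_pow_add_C (he _)]

lemma finSuccEquiv_shear_X_natDegree [IsDomain R] {e : Fin (n + 1) → ℕ} (he : e 0 = 1)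
    (j : Fin (n + 1)) : ((finSuccEquiv R n) (shear e (X j))).natDegree = e j := by
  by_cases h : j = 0
  · simp [h, shear, he, finSuccEquiv_X_zero]
  · obtain ⟨i, rfl⟩ := Fin.exists_succ_eq.mpr h
    simp [shear, finSuccEquiv_X_succ, finSuccEquiv_X_zero, add_comm]

lemma finSuccEquiv_shear_monomial [IsDomain R] {e : Fin (n + 1) → ℕ} (he : ∀ i, 0 < e i)
    (he' : e 0 = 1) (v : Fin (n + 1) →₀ ℕ) {a : R} (ha : a ≠ 0) :
    (finSuccEquiv R n (shear e (monomial v a))).leadingCoeff = C a ∧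
    (finSuccEquiv R n (shear e (monomial v a))).natDegree = ∑ i, e i * v i := by
  have hX : ∀ j, (finSuccEquiv R n) (shear e (X j)) ≠ 0 := fun j h => by
    have := finSuccEquiv_shear_X_leadingCoeff (R := R) he j
    simp [h] at this
  have hC : finSuccEquiv R n (shear e (C a)) = Polynomial.C (C a) := by
    rw [shear, algHom_C, algebraMap_eq, finSuccEquiv_apply, eval₂Hom_C]
    simp
  rw [monomial_eq, Finsupp.prod_fintype _ _ (fun i => pow_zero _)]
  simp only [map_mul, map_prod, map_pow, hC]
  constructor
  · simp [Polynomial.leadingCoeff_prod, finSuccEquiv_shear_X_leadingCoeff he]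
  · rw [Polynomial.natDegree_mul (by simpa using ha)
      (Finset.prod_ne_zero_iff.2 fun i _ => pow_ne_zero _ (hX i)),
      Polynomial.natDegree_prod _ _ fun i _ => pow_ne_zero _ (hX i)]
    simp [Polynomial.natDegree_pow, finSuccEquiv_shear_X_natDegree he', mul_comm]

lemma sum_pow_mul_injOn (u : ℕ) {v w : Fin (n + 1) →₀ ℕ} (hu : 1 < u) (hv : ∀ i, v i < u)
    (hw : ∀ i, w i < u) (h : ∑ i : Fin (n + 1), u ^ i.1 * v i = ∑ i : Fin (n + 1), u ^ i.1 * w i) :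
    v = w := by
  refine Finsupp.ext <| congrFun <| List.ofFn_inj.mp ?_
  apply Nat.ofDigits_inj_of_len_eq hu (by simp)
    (fun l hl => by obtain ⟨i, rfl⟩ := (List.mem_ofFn' _ _).1 hl; exact hv i)
    (fun l hl => by obtain ⟨i, rfl⟩ := (List.mem_ofFn' _ _).1 hl; exact hw i)
  simpa only [Nat.ofDigits_eq_sum_mapIdx, List.mapIdx_eq_ofFn, List.get_ofFn, List.length_ofFn,
    Fin.val_cast, mul_comm, List.sum_ofFn] using! h

/-- After a suitable shear, a nonzero polynomial has a leading coefficient (in `X_0`) that is a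
nonzero constant. -/
lemma exists_shear_leadingCoeff [IsDomain R] {f : MvPolynomial (Fin (n + 1)) R} (hf : f ≠ 0) :
    ∃ e : Fin (n + 1) → ℕ, ∃ l : R, l ≠ 0 ∧
      (finSuccEquiv R n (shear e f)).leadingCoeff = C l := by
  set u := 2 + f.totalDegree with hu
  set e : Fin (n + 1) → ℕ := fun i => u ^ i.1 with he
  have he1 : ∀ i, 0 < e i := fun i => pow_pos (by omega) _
  have he2 : e 0 = 1 := by simp [he]
  set h := fun w => finSuccEquiv R n (shear e (monomial w (coeff w f))) with hh
  obtain ⟨v, vin, vs⟩ := Finset.exists_max_image f.support (fun v => (h v).natDegree)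
    (support_nonempty.mpr hf)
  have key := fun w (hw : w ∈ f.support) =>
    finSuccEquiv_shear_monomial he1 he2 w (mem_support_iff.1 hw)
  have hlt : ∀ w ∈ f.support, ∀ i, w i < u := fun w hw i =>
    lt_of_le_of_lt ((monomial_le_degreeOf i hw).trans (degreeOf_le_totalDegree f i)) (by omega)
  have hne : h v ≠ 0 := fun h0 => by
    have := (key v vin).1
    rw [show finSuccEquiv R n (shear e (monomial v (coeff v f))) = h v from rfl, h0] at this
    simp only [Polynomial.leadingCoeff_zero] at this
    exact mem_support_iff.1 vin (C_injective _ _ (by rw [← this, C_0]))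
  refine ⟨e, coeff v f, mem_support_iff.1 vin, ?_⟩
  have hsum : finSuccEquiv R n (shear e f) = ∑ x ∈ f.support.erase v, h x + h v := by
    conv_lhs => rw [← f.support_sum_monomial_coeff]
    rw [map_sum, map_sum, Finset.sum_erase_add _ _ vin]
  rw [hsum, Polynomial.leadingCoeff_add_of_degree_lt, (key v vin).1]
  refine (Polynomial.degree_sum_le _ _).trans_lt ?_
  refine (Finset.sup_lt_iff (Ne.bot_lt fun x => hne (Polynomial.degree_eq_bot.mp x))).mpr ?_
  intro w hw
  obtain ⟨hwv, hwin⟩ := Finset.mem_erase.1 hw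
  refine Polynomial.degree_lt_degree (lt_of_le_of_ne (vs w hwin) fun heq => hwv ?_)
  have e1 := (key w hwin).2
  have e2 := (key v vin).2
  exact sum_pow_mul_injOn u (by omega) (hlt w hwin) (hlt v vin) (e1.symm.trans (heq.trans e2))

end Shear
end FibInf

namespace FibInf

section Discriminants

/-- The sum over `k`-element sets of indices of the products of all differences. -/
def sumDiscr (d k : ℕ) : MvPolynomial (Fin d) ℤ :=
  ∑ I ∈ powersetCard k univ, ∏ p ∈ I.offDiag, (X p.1 - X p.2)

lemma sumDiscr_isSymmetric (d k : ℕ) : (sumDiscr d k).IsSymmetric := by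
  intro σ
  simp only [sumDiscr, map_sum, map_prod, map_sub, rename_X]
  refine Finset.sum_equiv σ.finsetCongr (fun I => by simp [mem_powersetCard]) fun I _ => ?_
  refine Finset.prod_equiv (σ.prodCongr σ) (fun p => by simp) fun p _ => by simp

lemma aeval_sumDiscr {K : Type*} [CommRing K] (d k : ℕ) (β : Fin d → K) :
    aeval β (sumDiscr d k) = ∑ I ∈ powersetCard k univ, ∏ p ∈ I.offDiag, (β p.1 - β p.2) := by
  simp [sumDiscr]

lemma sumDiscr_eq_zero {K : Type*} [Field K] [DecidableEq K] {d k : ℕ} {β : Fin d → K}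
    (h : (univ.image β).card < k) : aeval β (sumDiscr d k) = 0 := by
  rw [aeval_sumDiscr]
  refine Finset.sum_eq_zero fun I hI => ?_
  obtain ⟨i, hi, j, hj, hij, e⟩ := Finset.exists_ne_map_eq_of_card_lt_of_maps_to
    (s := I) (t := univ.image β) (f := β) (by rw [(mem_powersetCard.1 hI).2]; exact h)
    (fun i _ => Finset.mem_coe.2 (mem_image_of_mem _ (mem_univ _)))
  exact Finset.prod_eq_zero (i := (i, j)) (mem_offDiag.2 ⟨hi, hj, hij⟩) (by simp [e])

lemma sumDiscr_ne_zero {K : Type*} [Field K] [CharZero K] [DecidableEq K] {d : ℕ} {β : Fin d → K} :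
    aeval β (sumDiscr d (univ.image β).card) ≠ 0 := by
  classical
  rw [aeval_sumDiscr]
  set T := univ.image β with hT
  set δ := ∏ p ∈ T.offDiag, (p.1 - p.2) with hδ
  have hδ0 : δ ≠ 0 := Finset.prod_ne_zero_iff.2 fun p hp =>
    sub_ne_zero.2 (mem_offDiag.1 hp).2.2
  have key : ∀ I ∈ powersetCard T.card (univ : Finset (Fin d)),
      ∏ p ∈ I.offDiag, (β p.1 - β p.2) = if Set.InjOn β I then δ else 0 := by
    intro I hI
    have hc := (mem_powersetCard.1 hI).2
    split_ifs with hinj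
    · have him : I.image β = T := by
        refine Finset.eq_of_subset_of_card_le (image_subset_image (subset_univ _)) ?_
        rw [Finset.card_image_of_injOn hinj, hc]
      rw [hδ]
      refine Finset.prod_bij (fun p _ => (β p.1, β p.2)) ?_ ?_ ?_ (fun _ _ => rfl)
      · intro p hp
        obtain ⟨h1, h2, h3⟩ := mem_offDiag.1 hp
        exact mem_offDiag.2 ⟨mem_image_of_mem _ (mem_univ _), mem_image_of_mem _ (mem_univ _),
          fun e => h3 (hinj h1 h2 e)⟩
      · intro p hp q hq e
        obtain ⟨h1, h2, h3⟩ := mem_offDiag.1 hp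
        obtain ⟨h1', h2', h3'⟩ := mem_offDiag.1 hq
        exact Prod.ext (hinj h1 h1' (Prod.ext_iff.1 e).1) (hinj h2 h2' (Prod.ext_iff.1 e).2)
      · rintro ⟨r, s⟩ hrs
        obtain ⟨h1, h2, h3⟩ := mem_offDiag.1 hrs
        rw [← him] at h1 h2
        obtain ⟨i, hi, rfl⟩ := mem_image.1 h1
        obtain ⟨j, hj, rfl⟩ := mem_image.1 h2
        exact ⟨(i, j), mem_offDiag.2 ⟨hi, hj, fun e => h3 (by rw [show i = j from e])⟩, rfl⟩
    · simp only [Set.InjOn, not_forall] at hinj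
      obtain ⟨i, hi, j, hj, e, hne⟩ := hinj
      exact Finset.prod_eq_zero (i := (i, j)) (mem_offDiag.2 ⟨hi, hj, hne⟩) (by simp [e])
  rw [Finset.sum_congr rfl key, ← Finset.sum_filter, Finset.sum_const, nsmul_eq_mul]
  refine mul_ne_zero (Nat.cast_ne_zero.2 (Finset.card_ne_zero.2 ?_)) hδ0
  obtain ⟨I, -, hinj, him⟩ := Finset.exists_subset_injOn_image_eq_of_surjOn
    (s := (univ : Finset (Fin d))) (t := T) (f := β) (by
      intro y hy
      obtain ⟨x, hx, rfl⟩ := mem_image.1 (Finset.mem_coe.1 hy)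
      exact ⟨x, by simp, rfl⟩)
  refine ⟨I, mem_filter.2 ⟨mem_powersetCard.2 ⟨subset_univ _, ?_⟩, hinj⟩⟩
  rw [← him, Finset.card_image_of_injOn hinj]

lemma exists_fin_roots {K : Type*} [Field K] [IsAlgClosed K] (p : Polynomial K) {d : ℕ}
    (hd : p.natDegree = d) : ∃ α : Fin d → K, p.roots = univ.val.map α := by
  have hc : p.roots.card = d := by rw [← hd]; exact IsAlgClosed.card_roots_eq_natDegree
  obtain ⟨l, hl⟩ := Quot.exists_rep p.roots
  have hl' : p.roots = (l : Multiset K) := hl.symm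
  have hlen : l.length = d := by rw [← hc, hl', Multiset.coe_card]
  subst hlen
  refine ⟨l.get, ?_⟩
  rw [hl', Fin.univ_val_map, List.ofFn_get]

/-- Polynomials in the coefficients of `Q` deciding the number of distinct roots. -/
lemma exists_discr {A : Type*} [CommRing A] (Q : Polynomial A) :
    ∃ D : ℕ → A, ∀ φ : A →+* ℂ, φ Q.leadingCoeff ≠ 0 →
      φ (D (Q.map φ).roots.toFinset.card) ≠ 0 ∧
      ∀ k, (Q.map φ).roots.toFinset.card < k → φ (D k) = 0 := by
  set d := Q.natDegree with hd
  set a := Q.leadingCoeff with ha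
  choose T hT using fun k => esymmAlgHom_surjective (σ := Fin d) (R := ℤ) (n := d) (by simp)
    ⟨sumDiscr d k, sumDiscr_isSymmetric d k⟩
  have hT' : ∀ k, aeval (fun i : Fin d => esymm (Fin d) ℤ (i + 1)) (T k) = sumDiscr d k :=
    fun k => by rw [← esymmAlgHom_apply, hT]
  refine ⟨fun k => aeval (fun i : Fin d => (-1) ^ (i.1 + 1) * Q.coeff (d - (i + 1)) * a ^ i.1)
    (T k), fun φ hφ => ?_⟩
  have hdeg : (Q.map φ).natDegree = d := Polynomial.natDegree_map_of_leadingCoeff_ne_zero φ hφ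
  have hlc : (Q.map φ).leadingCoeff = φ a := Polynomial.leadingCoeff_map_of_leadingCoeff_ne_zero φ hφ
  obtain ⟨α, hα⟩ := exists_fin_roots (Q.map φ) hdeg
  have hval : ∀ k, φ (aeval (fun i : Fin d => (-1) ^ (i.1 + 1) * Q.coeff (d - (i + 1)) * a ^ i.1)
      (T k)) = aeval (fun i => φ a * α i) (sumDiscr d k) := by
    intro k
    have e1 : φ (aeval (fun i : Fin d => (-1) ^ (i.1 + 1) * Q.coeff (d - (i + 1)) * a ^ i.1)
        (T k)) = aeval (fun i : Fin d => φ ((-1) ^ (i.1 + 1) * Q.coeff (d - (i + 1)) * a ^ i.1))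
        (T k) := by
      rw [show φ (aeval (fun i : Fin d => (-1) ^ (i.1 + 1) * Q.coeff (d - (i + 1)) * a ^ i.1)
        (T k)) = φ.toIntAlgHom (aeval (fun i : Fin d => (-1) ^ (i.1 + 1) *
          Q.coeff (d - (i + 1)) * a ^ i.1) (T k)) from rfl, comp_aeval_apply]
      rfl
    rw [e1, ← hT' k, comp_aeval_apply]
    congr 2
    funext i
    have hi : i.1 + 1 ≤ d := i.2
    have := Polynomial.coeff_eq_esymm_roots_of_card
      (p := Q.map φ) IsAlgClosed.card_roots_eq_natDegree (k := d - (i + 1)) (by omega)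
    rw [hlc, hdeg, show d - (d - (i.1 + 1)) = i.1 + 1 by omega, Polynomial.coeff_map] at this
    rw [map_mul, map_mul, this, aeval_esymm_eq_multiset_esymm, hα, Finset.esymm_map_val,
      Finset.esymm_map_val, map_pow, map_pow, map_neg, map_one]
    have e2 : ∑ t ∈ powersetCard (i.1 + 1) (univ : Finset (Fin d)), ∏ j ∈ t, (φ a * α j) =
        φ a ^ (i.1 + 1) * ∑ t ∈ powersetCard (i.1 + 1) (univ : Finset (Fin d)), ∏ j ∈ t, α j := by
      rw [Finset.mul_sum]
      refine Finset.sum_congr rfl fun t ht => ?_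
      rw [Finset.prod_mul_distrib, Finset.prod_const, (mem_powersetCard.1 ht).2]
    rw [e2]
    have : ((-1 : ℂ) ^ (i.1 + 1)) * (-1) ^ (i.1 + 1) = 1 := by
      rw [← mul_pow]; simp
    linear_combination (φ a ^ (i.1 + 1) *
      ∑ t ∈ powersetCard (i.1 + 1) (univ : Finset (Fin d)), ∏ j ∈ t, α j) * this
  have hcard : (Q.map φ).roots.toFinset.card = (univ.image (fun i => φ a * α i)).card := by
    have : univ.image (fun i => φ a * α i) = (Q.map φ).roots.toFinset.image (φ a * ·) := by
      ext y
      simp [hα]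
    rw [this, Finset.card_image_of_injective _ (mul_right_injective₀ hφ)]
  simp only [hval, hcard]
  exact ⟨sumDiscr_ne_zero, fun k hk => sumDiscr_eq_zero hk⟩

/-- A nonzero element whose divisors decide the number of distinct roots of `Q`. -/
lemma exists_discr_prod {A : Type*} [CommRing A] [IsDomain A] (Q : Polynomial A) :
    ∃ P : A, P ≠ 0 ∧ ∀ φ ψ : A →+* ℂ, φ Q.leadingCoeff ≠ 0 → ψ Q.leadingCoeff ≠ 0 →
      (∀ p, p ∣ P → (φ p = 0 ↔ ψ p = 0)) →
      (Q.map φ).roots.toFinset.card = (Q.map ψ).roots.toFinset.card := by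
  classical
  obtain ⟨D, hD⟩ := exists_discr Q
  refine ⟨∏ k ∈ range (Q.natDegree + 1), if D k = 0 then 1 else D k, ?_, ?_⟩
  · exact Finset.prod_ne_zero_iff.2 fun k _ => by split_ifs <;> simp_all
  · have bound : ∀ φ : A →+* ℂ, (Q.map φ).roots.toFinset.card ≤ Q.natDegree := fun φ =>
      (Multiset.toFinset_card_le _).trans ((Polynomial.card_roots' _).trans
        Polynomial.natDegree_map_le)
    have half : ∀ φ ψ : A →+* ℂ, φ Q.leadingCoeff ≠ 0 → ψ Q.leadingCoeff ≠ 0 →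
        (∀ p, p ∣ (∏ k ∈ range (Q.natDegree + 1), if D k = 0 then 1 else D k) →
          (φ p = 0 ↔ ψ p = 0)) →
        (Q.map φ).roots.toFinset.card ≤ (Q.map ψ).roots.toFinset.card := by
      intro φ ψ hφ hψ h
      by_contra! hlt
      have h1 := (hD φ hφ).1
      have h2 := (hD ψ hψ).2 _ hlt
      refine h1 ((h _ ?_).2 h2)
      have := Finset.dvd_prod_of_mem (fun k => if D k = 0 then 1 else D k)
        (mem_range.2 (Nat.lt_succ_of_le (bound φ)))
      rwa [if_neg (fun h0 => h1 (by rw [h0, map_zero]))] at this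
    exact fun φ ψ hφ hψ h => le_antisymm (half φ ψ hφ hψ h)
      (half ψ φ hψ hφ fun p hp => (h p hp).symm)

end Discriminants
end FibInf

namespace FibInf

section RootSections
open Filter Topology Polynomial

lemma Monic.exists_prod_X_sub_C {p : ℂ[X]} (hp : p.Monic) {d : ℕ} (hd : p.natDegree = d) :
    ∃ α : Fin d → ℂ, p = ∏ i, (Polynomial.X - Polynomial.C (α i)) := by
  have hc : p.roots.card = d := by rw [← hd]; exact IsAlgClosed.card_roots_eq_natDegree
  obtain ⟨l, hl⟩ := Quot.exists_rep p.roots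
  have hl' : p.roots = (l : Multiset ℂ) := hl.symm
  have hlen : l.length = d := by rw [← hc, hl', Multiset.coe_card]
  subst hlen
  refine ⟨l.get, ?_⟩
  have h := Polynomial.prod_multiset_X_sub_C_of_monic_of_roots_card_eq hp
    IsAlgClosed.card_roots_eq_natDegree
  rw [hl', ← List.ofFn_get l, ← Fin.univ_val_map, Multiset.map_map] at h
  conv_lhs => rw [← h]
  rfl

lemma exists_root_norm_lt {p : ℂ[X]} (hp : p.Monic) {w : ℂ} {ε : ℝ} (hε : 0 ≤ ε)
    (h : ‖p.eval w‖ < ε ^ p.natDegree) : ∃ r, p.IsRoot r ∧ ‖r - w‖ < ε := by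
  obtain ⟨α, hα⟩ := Monic.exists_prod_X_sub_C hp rfl
  by_contra! hc
  refine h.not_ge ?_
  have : ‖p.eval w‖ = ∏ i, ‖w - α i‖ := by
    conv_lhs => rw [hα]
    simp [Polynomial.eval_prod]
  rw [this]
  calc ε ^ p.natDegree = ∏ _i : Fin p.natDegree, ε := by simp
    _ ≤ _ := Finset.prod_le_prod (fun _ _ => hε) fun i _ => by
      rw [norm_sub_rev]
      refine hc (α i) ?_
      rw [hα, IsRoot, Polynomial.eval_prod]
      exact Finset.prod_eq_zero (mem_univ i) (by simp)

variable {T : Type*} [TopologicalSpace T] {q : T → ℂ[X]} {d m : ℕ}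

lemma continuous_eval_family (hd : ∀ t, (q t).natDegree ≤ d)
    (hc : ∀ k, Continuous fun t => (q t).coeff k) {X : Type*} [TopologicalSpace X]
    {f : X → T} {g : X → ℂ} (hf : Continuous f) (hg : Continuous g) :
    Continuous fun x => (q (f x)).eval (g x) := by
  have : (fun x => (q (f x)).eval (g x)) =
      fun x => ∑ i ∈ range (d + 1), (q (f x)).coeff i * g x ^ i := by
    funext x
    exact eval_eq_sum_range' (Nat.lt_succ_of_le (hd _)) _
  rw [this]
  exact continuous_finsetSum _ fun i _ => ((hc i).comp hf).mul (hg.pow i)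

lemma eventually_root_near (hm : ∀ t, (q t).Monic) (hd : ∀ t, (q t).natDegree = d)
    (hc : ∀ k, Continuous fun t => (q t).coeff k) {t : T} {w : ℂ} (h : (q t).IsRoot w) {ε : ℝ}
    (hε : 0 < ε) : ∀ᶠ t' in 𝓝 t, ∃ r, (q t').IsRoot r ∧ ‖r - w‖ < ε := by
  have h1 : Continuous fun t' => ‖(q t').eval w‖ :=
    (continuous_eval_family (fun t => (hd t).le) hc continuous_id continuous_const).norm
  have h2 : ∀ᶠ t' in 𝓝 t, ‖(q t').eval w‖ < ε ^ d :=
    h1.continuousAt.eventually_lt continuousAt_const (by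
      simp only [h.eq_zero, norm_zero]
      positivity)
  filter_upwards [h2] with t' ht'
  exact exists_root_norm_lt (hm t') hε.le (by rwa [hd])

lemma exists_separating (F : Finset ℂ) : ∃ δ > 0, ∀ x ∈ F, ∀ y ∈ F, x ≠ y → 2 * δ ≤ ‖x - y‖ := by
  obtain ⟨δ, hδ, h⟩ : ∃ δ > 0, ∀ p ∈ F.offDiag, δ ≤ ‖p.1 - p.2‖ := by
    by_cases hne : F.offDiag.Nonempty
    · obtain ⟨p, hp, hmin⟩ := F.offDiag.exists_min_image (fun p => ‖p.1 - p.2‖) hne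
      exact ⟨_, norm_pos_iff.2 (sub_ne_zero.2 (mem_offDiag.1 hp).2.2), hmin⟩
    · exact ⟨1, one_pos, fun p hp => (hne ⟨p, hp⟩).elim⟩
  refine ⟨δ / 2, by positivity, fun x hx y hy hxy => ?_⟩
  have := h (x, y) (mem_offDiag.2 ⟨hx, hy, hxy⟩)
  simpa [mul_div_cancel₀] using this

/-- Locally, the roots of a family with a constant number of distinct roots are separated by
fixed disjoint balls. -/
lemma exists_local_roots (hm : ∀ t, (q t).Monic) (hd : ∀ t, (q t).natDegree = d)
    (hc : ∀ k, Continuous fun t => (q t).coeff k)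
    (hcard : ∀ t, (q t).roots.toFinset.card = m) (t₁ : T) :
    ∃ δ > 0, (∀ i j : (q t₁).roots.toFinset, i ≠ j → 2 * δ ≤ ‖(i : ℂ) - j‖) ∧
      ∃ N : Set T, IsOpen N ∧ t₁ ∈ N ∧ ∃ s : (q t₁).roots.toFinset → T → ℂ,
        ∀ t ∈ N, (∀ i, (q t).IsRoot (s i t)) ∧ (∀ i, ‖s i t - i‖ < δ) ∧
          ∀ w, (q t).IsRoot w → ∃ i, w = s i t := by
  classical
  obtain ⟨δ, hδ, hsep⟩ := exists_separating (q t₁).roots.toFinset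
  have hev : ∀ᶠ t in 𝓝 t₁, ∀ i : (q t₁).roots.toFinset, ∃ r, (q t).IsRoot r ∧ ‖r - i‖ < δ := by
    rw [eventually_all]
    intro i
    exact eventually_root_near hm hd hc (isRoot_of_mem_roots (Multiset.mem_toFinset.1 i.2)) hδ
  obtain ⟨N, hN, hNo, htN⟩ := eventually_nhds_iff.1 hev
  have : ∀ i : (q t₁).roots.toFinset, ∀ t, ∃ r, t ∈ N → (q t).IsRoot r ∧ ‖r - i‖ < δ :=
    fun i t => by
      by_cases ht : t ∈ N
      · obtain ⟨r, hr⟩ := hN t ht i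
        exact ⟨r, fun _ => hr⟩
      · exact ⟨0, fun h => (ht h).elim⟩
  choose s hs using this
  have hsep' : ∀ i j : (q t₁).roots.toFinset, i ≠ j → 2 * δ ≤ ‖(i : ℂ) - j‖ := fun i j hij =>
    hsep i i.2 j j.2 (fun h => hij (Subtype.ext h))
  refine ⟨δ, hδ, hsep', N, hNo, htN, s, fun t ht => ⟨fun i => (hs i t ht).1, fun i => (hs i t ht).2,
    fun w hw => ?_⟩⟩
  have hinj : Function.Injective fun i => s i t := by
    intro i j hij
    by_contra hne
    have h1 := hsep' i j hne
    have h2 := (hs i t ht).2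
    have h3 := (hs j t ht).2
    have hij' : s i t = s j t := hij
    rw [hij'] at h2
    have : ‖(i : ℂ) - j‖ ≤ ‖s j t - i‖ + ‖s j t - j‖ := by
      rw [← norm_sub_rev (i : ℂ)]
      exact norm_sub_le_norm_sub_add_norm_sub _ _ _
    linarith
  have himg : univ.image (fun i => s i t) = (q t).roots.toFinset := by
    refine Finset.eq_of_subset_of_card_le ?_ ?_
    · intro w hw
      obtain ⟨i, -, rfl⟩ := mem_image.1 hw
      exact Multiset.mem_toFinset.2 ((mem_roots (hm t).ne_zero).2 (hs i t ht).1)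
    · rw [Finset.card_image_of_injective _ hinj, hcard, Finset.card_univ, Fintype.card_coe, hcard]
  have : w ∈ univ.image (fun i => s i t) := by
    rw [himg]
    exact Multiset.mem_toFinset.2 ((mem_roots (hm t).ne_zero).2 hw)
  obtain ⟨i, -, rfl⟩ := mem_image.1 this
  exact ⟨i, rfl⟩

/-- The zero set of a family of polynomials. -/
abbrev RootSpace (q : T → ℂ[X]) := {p : T × ℂ // (q p.1).IsRoot p.2}

lemma isCoveringMap_rootSpace (hm : ∀ t, (q t).Monic) (hd : ∀ t, (q t).natDegree = d)
    (hc : ∀ k, Continuous fun t => (q t).coeff k)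
    (hcard : ∀ t, (q t).roots.toFinset.card = m) :
    IsCoveringMap (fun e : RootSpace q => e.1.1) := by
  classical
  intro t₁
  obtain ⟨δ, hδ, hsep, N, hNo, htN, s, hs⟩ := exists_local_roots hm hd hc hcard t₁
  have huniq : ∀ t ∈ N, ∀ (i : (q t₁).roots.toFinset) (w : ℂ), (q t).IsRoot w → ‖w - i‖ < δ → w = s i t := by
    intro t ht i w hw hwi
    obtain ⟨j, rfl⟩ := (hs t ht).2.2 w hw
    by_cases hij : i = j
    · rw [hij]
    · exfalso
      have h1 := hsep i j hij
      have h3 := (hs t ht).2.1 j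
      have : ‖(i : ℂ) - j‖ ≤ ‖s j t - i‖ + ‖s j t - j‖ := by
        rw [← norm_sub_rev (i : ℂ)]
        exact norm_sub_le_norm_sub_add_norm_sub _ _ _
      linarith
  have hinj : ∀ t ∈ N, ∀ i j, s i t = s j t → i = j := by
    intro t ht i j hij
    by_contra hne
    have h1 := hsep i j hne
    have h2 := (hs t ht).2.1 i
    have h3 := (hs t ht).2.1 j
    rw [hij] at h2
    have : ‖(i : ℂ) - j‖ ≤ ‖s j t - i‖ + ‖s j t - j‖ := by
      rw [← norm_sub_rev (i : ℂ)]
      exact norm_sub_le_norm_sub_add_norm_sub _ _ _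
    linarith
  have hcont : ∀ i, ContinuousOn (s i) N := by
    intro i t ht
    refine ContinuousAt.continuousWithinAt ?_
    rw [Metric.continuousAt_iff']
    intro ε hε
    have hη : 0 < min ε (δ - ‖s i t - i‖) := lt_min hε (sub_pos.2 ((hs t ht).2.1 i))
    filter_upwards [eventually_root_near hm hd hc ((hs t ht).1 i) hη, hNo.mem_nhds ht] with t' h1 h2
    obtain ⟨r, hr, hlt⟩ := h1
    have hri : ‖r - i‖ < δ := by
      have := norm_sub_le_norm_sub_add_norm_sub r (s i t) (i : ℂ)
      have := hlt.trans_le (min_le_right _ _)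
      linarith
    rw [dist_eq_norm, ← huniq t' h2 i r hr hri]
    exact hlt.trans_le (min_le_left _ _)
  choose idx hidx using fun (e : (fun e : RootSpace q => e.1.1) ⁻¹' N) =>
    (hs e.1.1.1 e.2).2.2 e.1.1.2 e.1.2
  have hidx_cont : Continuous idx := by
    rw [continuous_discrete_rng]
    intro i
    have : idx ⁻¹' {i} = {e | ‖e.1.1.2 - (i : ℂ)‖ < δ} := by
      ext e
      simp only [Set.mem_preimage, Set.mem_singleton_iff, Set.mem_ofPred_eq]
      constructor
      · rintro rfl
        rw [hidx e]
        exact (hs _ e.2).2.1 _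
      · intro h
        have := huniq _ e.2 i _ e.1.2 h
        rw [hidx e] at this
        exact hinj _ e.2 _ _ this
    rw [this]
    exact isOpen_lt (by fun_prop) continuous_const
  refine IsEvenlyCovered.to_isEvenlyCovered_preimage (I := (q t₁).roots.toFinset)
    ⟨inferInstance, N, htN, hNo, hNo.preimage (by fun_prop), ?_⟩
  refine ⟨{ toFun := fun e => (⟨e.1.1.1, e.2⟩, idx e)
            invFun := fun p => ⟨⟨(p.1, s p.2 p.1), (hs _ p.1.2).1 _⟩, p.1.2⟩
            left_inv := fun e => Subtype.ext (Subtype.ext (Prod.ext rfl (hidx e).symm))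
            right_inv := fun p => Prod.ext rfl
              (hinj _ p.1.2 _ _ (hidx ⟨⟨(p.1, s p.2 p.1), (hs _ p.1.2).1 _⟩, p.1.2⟩).symm)
            continuous_toFun := ?_
            continuous_invFun := ?_ }, fun _ => rfl⟩
  · exact Continuous.prodMk (by fun_prop) hidx_cont
  · refine Continuous.subtype_mk (Continuous.subtype_mk (Continuous.prodMk (by fun_prop) ?_) _) _
    rw [continuous_prod_of_discrete_right]
    intro i
    exact (continuousOn_iff_continuous_domRestrict.1 (hcont i))

/-- Distinct continuous root functions exhausting the roots. -/
lemma exists_root_functions [SimplyConnectedSpace T] [LocallyPathConnectedSpace T]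
    (hm : ∀ t, (q t).Monic) (hd : ∀ t, (q t).natDegree = d)
    (hc : ∀ k, Continuous fun t => (q t).coeff k)
    (hcard : ∀ t, (q t).roots.toFinset.card = m) :
    ∃ β : Fin m → T → ℂ, (∀ i, Continuous (β i)) ∧ (∀ i j, i ≠ j → ∀ t, β i t ≠ β j t) ∧
      ∀ t w, (q t).IsRoot w ↔ ∃ i, w = β i t := by
  classical
  have hcov := isCoveringMap_rootSpace hm hd hc hcard
  obtain ⟨t₀⟩ : Nonempty T := inferInstance
  have e : Fin m ≃ (q t₀).roots.toFinset := (Fintype.equivFinOfCardEq (by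
    rw [Fintype.card_coe, hcard])).symm
  choose σ hσ _ using fun i : Fin m => hcov.existsUnique_continuousMap_lifts
    (ContinuousMap.id T) t₀
    ⟨(t₀, (e i : ℂ)), isRoot_of_mem_roots (Multiset.mem_toFinset.1 (e i).2)⟩ rfl
  have h1 : ∀ i t, (σ i t).1.1 = t := fun i t => congrFun (hσ i).2 t
  have hne : ∀ i j, i ≠ j → ∀ t, (σ i t).1.2 ≠ (σ j t).1.2 := by
    intro i j hij t heq
    have : σ i t = σ j t := Subtype.ext (Prod.ext ((h1 i t).trans (h1 j t).symm) heq)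
    have := hcov.eq_of_comp_eq (σ i).continuous (σ j).continuous ((hσ i).2.trans (hσ j).2.symm) t
      this
    have h0 := congrFun this t₀
    rw [(hσ i).1, (hσ j).1] at h0
    exact hij (e.injective (Subtype.ext (Prod.ext_iff.1 (Subtype.ext_iff.1 h0)).2))
  refine ⟨fun i t => (σ i t).1.2, fun i => by fun_prop, hne, fun t w => ?_⟩
  have hroot : ∀ i, (q t).IsRoot (σ i t).1.2 := fun i => by
    have := (σ i t).2
    rwa [h1] at this
  constructor
  · intro hw
    have himg : univ.image (fun i => (σ i t).1.2) = (q t).roots.toFinset := by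
      refine Finset.eq_of_subset_of_card_le ?_ ?_
      · intro w hw
        obtain ⟨i, -, rfl⟩ := mem_image.1 hw
        exact Multiset.mem_toFinset.2 ((mem_roots (hm t).ne_zero).2 (hroot i))
      · rw [Finset.card_image_of_injective _ (fun i j hij => by
          by_contra h; exact hne i j h t hij), hcard, Finset.card_univ, Fintype.card_fin]
    have : w ∈ univ.image (fun i => (σ i t).1.2) := by
      rw [himg]
      exact Multiset.mem_toFinset.2 ((mem_roots (hm t).ne_zero).2 hw)
    obtain ⟨i, -, rfl⟩ := mem_image.1 this
    exact ⟨i, rfl⟩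
  · rintro ⟨i, rfl⟩
    exact hroot i

end RootSections
end FibInf

namespace FibInf

section Multiplicities
open Filter Topology Polynomial

variable {T : Type*} [TopologicalSpace T]

lemma isClosed_le_rootMultiplicity {p : T → ℂ[X]} {d : ℕ} (hp : ∀ t, p t ≠ 0)
    (hd : ∀ t, (p t).natDegree ≤ d) (hc : ∀ k, Continuous fun t => (p t).coeff k)
    {β : T → ℂ} (hβ : Continuous β) (k : ℕ) :
    IsClosed {t | k ≤ (p t).rootMultiplicity (β t)} := by
  cases k with
  | zero => simp
  | succ n =>
    have : {t | n + 1 ≤ (p t).rootMultiplicity (β t)} =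
        ⋂ m ∈ Set.Iic n, {t | (derivative^[m] (p t)).eval (β t) = 0} := by
      ext t
      simp only [Set.mem_ofPred_eq, Set.mem_iInter, Set.mem_Iic]
      exact lt_rootMultiplicity_iff_isRoot_iterate_derivative (hp t)
    rw [this]
    refine isClosed_biInter fun m _ => isClosed_eq ?_ continuous_const
    refine continuous_eval_family (d := d) (q := fun t => derivative^[m] (p t)) (f := id)
      (fun t => (natDegree_iterate_derivative _ _).trans ((Nat.sub_le _ _).trans (hd t)))
      (fun k => ?_) continuous_id hβ
    simp only [coeff_iterate_derivative]
    exact (hc _).const_smul _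

lemma eq_of_isClosed_of_sum_eq [PreconnectedSpace T] {ι : Type*} [Fintype ι] {n : ι → T → ℕ}
    {d : ℕ} (hcl : ∀ i k, IsClosed {t | k ≤ n i t}) (hsum : ∀ t, ∑ i, n i t = d) (i : ι)
    (t t' : T) : n i t = n i t' := by
  refine IsLocallyConstant.apply_eq_of_preconnectedSpace
    ((IsLocallyConstant.iff_eventually_eq _).2 fun t₁ => ?_) t t'
  have h : ∀ᶠ t in 𝓝 t₁, ∀ j, n j t ≤ n j t₁ := by
    rw [eventually_all]
    intro j
    have := (hcl j (n j t₁ + 1)).isOpen_compl.mem_nhds (x := t₁) (by simp)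
    filter_upwards [this] with t ht
    simpa [Nat.lt_succ_iff] using ht
  filter_upwards [h] with t ht
  exact (Finset.sum_eq_sum_iff_of_le fun j _ => ht j).1 ((hsum t).trans (hsum t₁).symm) i
    (mem_univ i)

lemma prod_X_sub_C_pow_eq {p : ℂ[X]} (hp : p.Monic) {m : ℕ} {β : Fin m → ℂ}
    (hinj : Function.Injective β) (hβ : ∀ w, p.IsRoot w ↔ ∃ i, w = β i) :
    p = ∏ i, (Polynomial.X - Polynomial.C (β i)) ^ p.rootMultiplicity (β i) ∧
    ∑ i, p.rootMultiplicity (β i) = p.natDegree := by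
  classical
  have himg : p.roots.toFinset = univ.image β := by
    ext w
    rw [Multiset.mem_toFinset, mem_roots hp.ne_zero, hβ]
    simp [eq_comm]
  constructor
  · have h := Polynomial.prod_multiset_X_sub_C_of_monic_of_roots_card_eq hp
      IsAlgClosed.card_roots_eq_natDegree
    rw [prod_multiset_root_eq_finset_root, himg, Finset.prod_image hinj.injOn] at h
    exact h.symm
  · rw [← IsAlgClosed.card_roots_eq_natDegree (p := p), ← Multiset.toFinset_sum_count_eq, himg,
      Finset.sum_image hinj.injOn]
    simp

lemma hasDerivAt_mul_of_eq_zero {h g : ℂ → ℂ} {h' t : ℂ} (hh : HasDerivAt h h' t)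
    (h0 : h t = 0) (hg : ContinuousAt g t) :
    HasDerivAt (fun s => h s * g s) (h' * g t) t := by
  rw [hasDerivAt_iff_tendsto_slope] at hh ⊢
  have : slope (fun s => h s * g s) t = fun s => slope h t s * g s := by
    funext s
    simp [slope_def_field, h0]
    ring
  rw [this]
  exact hh.mul (hg.mono_left nhdsWithin_le_nhds)

lemma differentiableAt_root {p : ℂ → ℂ[X]} {d : ℕ} {t₁ : ℂ} {β : ℂ → ℂ}
    (hd : ∀ᶠ t in 𝓝 t₁, (p t).natDegree ≤ d)
    (hc : ∀ k, DifferentiableAt ℂ (fun t => (p t).coeff k) t₁) (hβ : ContinuousAt β t₁)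
    (hroot : ∀ᶠ t in 𝓝 t₁, (p t).eval (β t) = 0)
    (hder : (derivative (p t₁)).eval (β t₁) ≠ 0) : DifferentiableAt ℂ β t₁ := by
  set y := β t₁ with hy
  set h : ℂ → ℂ := fun t => ∑ k ∈ range (d + 1), (p t).coeff k * y ^ k with hh
  set G : ℂ → ℂ := fun t => ∑ k ∈ range (d + 1), (p t).coeff k *
    ∑ i ∈ range k, β t ^ i * y ^ (k - 1 - i) with hG
  have hhd : DifferentiableAt ℂ h t₁ :=
    DifferentiableAt.fun_sum fun k _ => (hc k).mul_const _
  have hGc : ContinuousAt G t₁ := by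
    refine tendsto_finsetSum _ fun k _ => ((hc k).continuousAt).mul ?_
    exact tendsto_finsetSum _ fun i _ => (hβ.pow i).mul continuousAt_const
  have hG1 : G t₁ ≠ 0 := by
    rw [derivative_eval, sum_over_range' _ (by simp) (d + 1) (Nat.lt_succ_of_le hd.self_of_nhds)]
      at hder
    convert hder using 1
    refine Finset.sum_congr rfl fun k _ => ?_
    rw [← hy, geom_sum₂_self, mul_assoc]
  have hrel : ∀ᶠ t in 𝓝 t₁, h t + (β t - y) * G t = 0 := by
    filter_upwards [hd, hroot] with t hdt ht
    rw [eval_eq_sum_range' (Nat.lt_succ_of_le hdt)] at ht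
    rw [← ht, hh, hG, Finset.mul_sum, ← Finset.sum_add_distrib]
    refine Finset.sum_congr rfl fun k _ => ?_
    linear_combination (p t).coeff k * geom_sum₂_mul (β t) y k
  have h0 : h t₁ = 0 := by
    have := hrel.self_of_nhds
    simpa [← hy] using this
  have hev : β =ᶠ[𝓝 t₁] fun t => y - h t * (G t)⁻¹ := by
    filter_upwards [hrel, hGc.eventually_ne hG1] with t ht hGt
    field_simp
    linear_combination ht
  refine (DifferentiableAt.congr_of_eventuallyEq ?_ hev)
  exact (differentiableAt_const _).sub
    (hasDerivAt_mul_of_eq_zero hhd.hasDerivAt h0 (hGc.inv₀ hG1)).differentiableAt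

/-- Holomorphic families of monic polynomials over a disc with a constant number of distinct
roots split into holomorphic linear factors, two of which are either equal or nowhere equal. -/
lemma exists_holomorphic_roots {t₀ : ℂ} {ρ : ℝ} (hρ : 0 < ρ) {q : ℂ → ℂ[X]} {d m : ℕ}
    (hm : ∀ t ∈ Metric.ball t₀ ρ, (q t).Monic)
    (hd : ∀ t ∈ Metric.ball t₀ ρ, (q t).natDegree = d)
    (hc : ∀ k, DifferentiableOn ℂ (fun t => (q t).coeff k) (Metric.ball t₀ ρ))
    (hcard : ∀ t ∈ Metric.ball t₀ ρ, (q t).roots.toFinset.card = m) :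
    ∃ b : Fin d → ℂ → ℂ, (∀ j, DifferentiableOn ℂ (b j) (Metric.ball t₀ ρ)) ∧
      (∀ t ∈ Metric.ball t₀ ρ, q t = ∏ j, (Polynomial.X - Polynomial.C (b j t))) ∧
      ∀ i j, (∀ t ∈ Metric.ball t₀ ρ, b i t = b j t) ∨ ∀ t ∈ Metric.ball t₀ ρ, b i t ≠ b j t := by
  classical
  set B := Metric.ball t₀ ρ with hB
  have ht₀ : t₀ ∈ B := Metric.mem_ball_self hρ
  have hBo : IsOpen B := Metric.isOpen_ball
  have : ContractibleSpace B := (convex_ball t₀ ρ).contractibleSpace ⟨t₀, ht₀⟩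
  have : LocallyPathConnectedSpace B := hBo.locallyPathConnectedSpace
  have hcB : ∀ k, Continuous fun t : B => (q t).coeff k := fun k =>
    (hc k).continuousOn.domRestrict
  obtain ⟨β, hβc, hβne, hβr⟩ := exists_root_functions (T := B) (q := fun t => q t)
    (fun t => hm t t.2) (fun t => hd t t.2) hcB (fun t => hcard t t.2)
  have hinj : ∀ t, Function.Injective fun i => β i t := fun t i j hij => by
    by_contra h
    exact hβne i j h t hij
  have hdec := fun t : B => prod_X_sub_C_pow_eq (hm t t.2) (hinj t) (hβr t)
  set μ : Fin m → ℕ := fun i => (q t₀).rootMultiplicity (β i ⟨t₀, ht₀⟩) with hμ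
  have hconst : ∀ i (t : B), (q t).rootMultiplicity (β i t) = μ i := fun i t =>
    eq_of_isClosed_of_sum_eq (T := B) (n := fun i t => (q t).rootMultiplicity (β i t)) (d := d)
      (fun i k => isClosed_le_rootMultiplicity (p := fun t : B => q t)
        (fun t => (hm t t.2).ne_zero) (fun t => (hd t t.2).le) hcB (hβc i) k)
      (fun t => (hdec t).2.trans (hd t t.2)) i t ⟨t₀, ht₀⟩
  have hμpos : ∀ i, 0 < μ i := fun i =>
    (rootMultiplicity_pos (hm t₀ ht₀).ne_zero).2 ((hβr ⟨t₀, ht₀⟩ _).2 ⟨i, rfl⟩)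
  have hμsum : ∑ i, μ i = d := (hdec ⟨t₀, ht₀⟩).2.trans (hd t₀ ht₀)
  set γ : Fin m → ℂ → ℂ := fun i t => if h : t ∈ B then β i ⟨t, h⟩ else 0 with hγ
  have hγB : ∀ i t (h : t ∈ B), γ i t = β i ⟨t, h⟩ := fun i t h => by simp [hγ, h]
  have hγc : ∀ i, ContinuousOn (γ i) B := fun i => by
    rw [continuousOn_iff_continuous_domRestrict]
    convert hβc i using 1
    funext t
    exact hγB i t t.2
  have hγd : ∀ i, DifferentiableOn ℂ (γ i) B := by
    intro i t₁ ht₁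
    refine DifferentiableAt.differentiableWithinAt ?_
    have hlt := fun (n : ℕ) (t : ℂ) (ht : t ∈ B) =>
      lt_rootMultiplicity_iff_isRoot_iterate_derivative (hm t ht).ne_zero (t := β i ⟨t, ht⟩) (n := n)
    refine differentiableAt_root (p := fun t => derivative^[μ i - 1] (q t)) (d := d) ?_ ?_
      ((hγc i).continuousAt (hBo.mem_nhds ht₁)) ?_ ?_
    · filter_upwards [hBo.mem_nhds ht₁] with t ht
      exact (natDegree_iterate_derivative _ _).trans ((Nat.sub_le _ _).trans (hd t ht).le)
    · intro k
      simp only [coeff_iterate_derivative]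
      exact ((hc _).differentiableAt (hBo.mem_nhds ht₁)).const_smul _
    · filter_upwards [hBo.mem_nhds ht₁] with t ht
      rw [hγB i t ht]
      refine (hlt (μ i - 1) t ht).1 ?_ _ le_rfl
      rw [hconst i ⟨t, ht⟩]
      have := hμpos i
      omega
    · intro h0
      rw [hγB i t₁ ht₁, ← Function.iterate_succ_apply' derivative,
        Nat.succ_eq_add_one, Nat.sub_add_cancel (hμpos i)] at h0
      have := (hlt (μ i) t₁ ht₁).2 fun n hn => by
        rcases hn.eq_or_lt with rfl | hn
        · exact h0
        · refine (hlt (μ i - 1) t₁ ht₁).1 ?_ n (by omega)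
          rw [hconst i ⟨t₁, ht₁⟩]
          have := hμpos i
          omega
      rw [hconst i ⟨t₁, ht₁⟩] at this
      exact lt_irrefl _ this
  let e : Fin d ≃ (i : Fin m) × Fin (μ i) := (finCongr hμsum.symm).trans finSigmaFinEquiv.symm
  refine ⟨fun j => γ (e j).1, fun j => hγd _, fun t ht => ?_, fun i j => ?_⟩
  · rw [e.prod_comp (fun x => (Polynomial.X - Polynomial.C (γ x.1 t))), Fintype.prod_sigma]
    refine ((hdec ⟨t, ht⟩).1).trans ?_
    simp [hconst _ ⟨t, ht⟩, hγB _ t ht]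
  · by_cases h : (e i).1 = (e j).1
    · left
      intro t _
      show γ (e i).1 t = γ (e j).1 t
      rw [h]
    · right
      intro t ht
      show γ (e i).1 t ≠ γ (e j).1 t
      rw [hγB _ t ht, hγB _ t ht]
      exact hβne _ _ h _

end Multiplicities
end FibInf

namespace FibInf

section Distortion
open Filter Topology Metric

/-- If the derivative varies by a factor at most three on a ball, then the image contains a ball. -/
lemma ball_subset_image_of_norm_deriv_le {H : ℂ → ℂ} {z₁ : ℂ} {s : ℝ} (hs : 0 < s)
    (hH : DifferentiableOn ℂ H (ball z₁ s)) (h0 : deriv H z₁ ≠ 0)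
    (hb : ∀ z ∈ ball z₁ s, ‖deriv H z‖ ≤ 3 * ‖deriv H z₁‖) :
    ball (H z₁) (‖deriv H z₁‖ * s / 32) ⊆ H '' ball z₁ s := by
  set D := deriv H z₁ with hD
  have hDpos : 0 < ‖D‖ := norm_pos_iff.2 h0
  have hsub : closedBall z₁ (s / 8) ⊆ ball z₁ s := closedBall_subset_ball (by linarith)
  have hd' : DifferentiableOn ℂ (deriv H) (ball z₁ s) := hH.deriv isOpen_ball
  have hmaps : Set.MapsTo (deriv H) (ball z₁ s) (closedBall (deriv H z₁) (4 * ‖D‖)) := by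
    intro z hz
    rw [mem_closedBall, dist_eq_norm]
    calc ‖deriv H z - deriv H z₁‖ ≤ ‖deriv H z‖ + ‖D‖ := norm_sub_le _ _
      _ ≤ 4 * ‖D‖ := by linarith [hb z hz]
  have hdev : ∀ z ∈ closedBall z₁ (s / 8), ‖deriv H z - D‖ ≤ ‖D‖ / 2 := by
    intro z hz
    have := Complex.dist_le_div_mul_dist_of_mapsTo_ball hd' hmaps (hsub hz)
    rw [dist_eq_norm] at this
    refine this.trans ?_
    calc 4 * ‖D‖ / s * dist z z₁ ≤ 4 * ‖D‖ / s * (s / 8) := by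
          gcongr
          exact hz
      _ = ‖D‖ / 2 := by field_simp; norm_num
  have hlow : ∀ z ∈ closedBall z₁ (s / 8), ‖D‖ / 2 * ‖z - z₁‖ ≤ ‖H z - H z₁‖ := by
    intro z hz
    have key := (convex_closedBall z₁ (s / 8)).norm_image_sub_le_of_norm_hasDerivWithin_le
      (f := fun z => H z - D * z) (f' := fun z => deriv H z - D) (C := ‖D‖ / 2)
      (x := z₁) (y := z)
      (fun x hx => by
        have h1 : HasDerivAt H (deriv H x) x :=
          (hH.differentiableAt (isOpen_ball.mem_nhds (hsub hx))).hasDerivAt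
        exact ((h1.sub ((hasDerivAt_id x).const_mul D)).congr_deriv
          (by rw [mul_one])).hasDerivWithinAt)
      hdev (mem_closedBall_self (by positivity)) hz
    have e : D * (z - z₁) = (H z - H z₁) - ((H z - D * z) - (H z₁ - D * z₁)) := by ring
    have := norm_sub_le (H z - H z₁) ((H z - D * z) - (H z₁ - D * z₁))
    rw [← e, norm_mul] at this
    linarith
  have hdc : DiffContOnCl ℂ H (ball z₁ (s / 8)) :=
    (hH.mono hsub).diffContOnCl_ball (subset_refl _)
  have := hdc.ball_subset_image_closedBall (ε := ‖D‖ * s / 16) (by positivity)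
    (fun z hz => by
      refine le_trans (le_of_eq ?_) (hlow z (sphere_subset_closedBall hz))
      rw [mem_sphere, dist_eq_norm] at hz
      rw [hz]; ring)
    (by
      refine Eventually.frequently (f := 𝓝[≠] z₁) ?_ |>.filter_mono nhdsWithin_le_nhds
      filter_upwards [self_mem_nhdsWithin,
        nhdsWithin_le_nhds (closedBall_mem_nhds z₁ (show 0 < s / 8 by positivity))] with z hz hz'
      intro h
      have := hlow z hz'
      rw [h, sub_self, norm_zero] at this
      have h2 : 0 < ‖z - z₁‖ := norm_pos_iff.2 (sub_ne_zero.2 hz)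
      nlinarith [mul_pos hDpos h2])
  have e : ‖D‖ * s / 32 = ‖D‖ * s / 16 / 2 := by ring
  rw [e]
  exact this.trans (Set.image_mono hsub)

/-- A holomorphic function on a ball of radius `ρ` whose image contains no ball of radius `L`
has derivative at most `256 L / ρ` on the quarter ball (a weak form of Bloch's theorem). -/
lemma norm_deriv_le_of_not_ball_subset {H : ℂ → ℂ} {t₀ : ℂ} {ρ L : ℝ} (hρ : 0 < ρ)
    (hH : DifferentiableOn ℂ H (ball t₀ ρ)) (hL : ∀ w, ¬ ball w L ⊆ H '' ball t₀ ρ)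
    {z : ℂ} (hz : z ∈ ball t₀ (ρ / 4)) : ‖deriv H z‖ ≤ 256 * L / ρ := by
  set r := ρ / 2 with hr
  have hsub : closedBall t₀ r ⊆ ball t₀ ρ := closedBall_subset_ball (by linarith)
  have hcont : ContinuousOn (fun z => (r - ‖z - t₀‖) * ‖deriv H z‖) (closedBall t₀ r) :=
    (by fun_prop : Continuous fun z : ℂ => r - ‖z - t₀‖).continuousOn.mul
      (((hH.deriv isOpen_ball).continuousOn.mono hsub).norm)
  obtain ⟨z₁, hz₁, hmax⟩ := (isCompact_closedBall t₀ r).exists_isMaxOn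
    ⟨t₀, mem_closedBall_self (by positivity)⟩ hcont
  set M := (r - ‖z₁ - t₀‖) * ‖deriv H z₁‖ with hM
  have hmax' : ∀ y, ‖y - t₀‖ ≤ r → (r - ‖y - t₀‖) * ‖deriv H y‖ ≤ M := fun y hy =>
    hmax (mem_closedBall_iff_norm.2 hy)
  have hML : M ≤ 64 * L := by
    by_contra! hlt
    have hL0 : 0 < M := by
      have h1 : 0 ≤ M := le_trans
        (mul_nonneg (by simp only [sub_self, norm_zero, sub_zero]; positivity) (norm_nonneg _))
        (hmax' t₀ (by simp only [sub_self, norm_zero]; positivity))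
      refine h1.lt_of_ne fun h => ?_
      refine hL t₀ ?_
      rw [ball_eq_empty.2 (by linarith)]
      exact Set.empty_subset _
    have hz₁' : ‖z₁ - t₀‖ ≤ r := mem_closedBall_iff_norm.1 hz₁
    have ha : 0 < r - ‖z₁ - t₀‖ := by
      refine (sub_nonneg.2 hz₁').lt_of_ne fun h => ?_
      rw [hM, ← h, zero_mul] at hL0
      exact lt_irrefl _ hL0
    have hD : 0 < ‖deriv H z₁‖ := by
      refine (norm_nonneg _).lt_of_ne fun h => ?_
      rw [hM, ← h, mul_zero] at hL0
      exact lt_irrefl _ hL0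
    set s := (r - ‖z₁ - t₀‖) / 2 with hs
    have hs0 : 0 < s := by positivity
    have hin : ∀ y ∈ ball z₁ s, s ≤ r - ‖y - t₀‖ := by
      intro y hy
      rw [mem_ball_iff_norm] at hy
      have : ‖y - t₀‖ ≤ ‖y - z₁‖ + ‖z₁ - t₀‖ := norm_sub_le_norm_sub_add_norm_sub _ _ _
      linarith
    have hin' : ball z₁ s ⊆ ball t₀ ρ := fun y hy => by
      rw [mem_ball_iff_norm]
      linarith [hin y hy]
    have := ball_subset_image_of_norm_deriv_le hs0 (hH.mono hin') (norm_pos_iff.1 hD) (by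
      intro y hy
      have h1 := hmax' y (by linarith [hin y hy])
      have h2 : s * ‖deriv H y‖ ≤ s * (2 * ‖deriv H z₁‖) := by
        calc s * ‖deriv H y‖ ≤ (r - ‖y - t₀‖) * ‖deriv H y‖ := by
              gcongr; exact hin y hy
          _ ≤ M := h1
          _ = _ := by rw [hM, hs]; ring
      linarith [le_of_mul_le_mul_left h2 hs0])
    refine hL (H z₁) (((ball_subset_ball ?_).trans this).trans (Set.image_mono hin'))
    have : M = 2 * s * ‖deriv H z₁‖ := by rw [hM, hs]; ring
    linarith
  rw [mem_ball_iff_norm] at hz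
  have h1 := hmax' z (by linarith)
  have h2 : ρ / 4 * ‖deriv H z‖ ≤ 64 * L := by
    calc ρ / 4 * ‖deriv H z‖ ≤ (r - ‖z - t₀‖) * ‖deriv H z‖ := by
          gcongr; linarith
      _ ≤ _ := h1.trans hML
  rw [le_div_iff₀ hρ]
  linarith

lemma exists_exp_eq {h : ℂ → ℂ} {t₀ : ℂ} {ρ : ℝ} (hρ : 0 < ρ)
    (hd : DifferentiableOn ℂ h (ball t₀ ρ)) (h0 : ∀ t ∈ ball t₀ ρ, h t ≠ 0) :
    ∃ H : ℂ → ℂ, DifferentiableOn ℂ H (ball t₀ ρ) ∧ ∀ t ∈ ball t₀ ρ, h t = h t₀ * Complex.exp (H t - H t₀) := by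
  obtain ⟨H, hH⟩ := ((hd.deriv isOpen_ball).div hd h0).isExactOn_ball
  refine ⟨H, fun t ht => (hH t ht).differentiableAt.differentiableWithinAt, fun t ht => ?_⟩
  have hder : ∀ t ∈ ball t₀ ρ, HasDerivAt (fun t => h t * Complex.exp (-H t)) 0 t := by
    intro t ht
    have h1 : HasDerivAt h (deriv h t) t :=
      (hd.differentiableAt (isOpen_ball.mem_nhds ht)).hasDerivAt
    have e : h t * (deriv h t / h t) = deriv h t := mul_div_cancel₀ _ (h0 t ht)
    refine (h1.mul ((hH t ht).neg.cexp)).congr_deriv ?_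
    simp only [Pi.neg_apply, Pi.div_apply]
    linear_combination (-Complex.exp (-H t)) * e
  have := (convex_ball t₀ ρ).norm_image_sub_le_of_norm_hasDerivWithin_le (C := 0)
    (fun x hx => (hder x hx).hasDerivWithinAt) (by simp) (mem_ball_self hρ) ht
  rw [zero_mul, norm_le_zero_iff, sub_eq_zero] at this
  rw [sub_eq_add_neg, add_comm, Complex.exp_add, ← mul_assoc, ← this, mul_assoc, ← Complex.exp_add]
  simp

/-- A nowhere vanishing holomorphic function taking each value at most `p` times has bounded
distortion near the centre. -/
lemma norm_div_sub_one_le {h : ℂ → ℂ} {t₀ : ℂ} {ρ : ℝ} {p : ℕ} (hρ : 0 < ρ)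
    (hd : DifferentiableOn ℂ h (ball t₀ ρ)) (h0 : ∀ t ∈ ball t₀ ρ, h t ≠ 0)
    (hp : ∀ (y : ℂ) (s : Finset ℂ), (∀ t ∈ s, t ∈ ball t₀ ρ ∧ h t = y) → s.card ≤ p)
    {r : ℝ} (hr : r ≤ ρ / 4) (hr1 : 256 * (2 * Real.pi * (p + 1)) / ρ * r ≤ 1) {t : ℂ} (ht : t ∈ ball t₀ r) :
    ‖h t / h t₀ - 1‖ ≤ 2 * (256 * (2 * Real.pi * (p + 1)) / ρ * r) := by
  obtain ⟨H, hH, hhH⟩ := exists_exp_eq hρ hd h0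
  set L := 2 * Real.pi * (p + 1) with hL
  have hLpos : 0 < L := by positivity
  have hnot : ∀ w, ¬ ball w L ⊆ H '' ball t₀ ρ := by
    intro w hw
    have hpt : ∀ k : Fin (p + 1), ∃ t ∈ ball t₀ ρ, H t = w + 2 * Real.pi * k * Complex.I := by
      intro k
      refine hw ?_
      rw [mem_ball_iff_norm]
      have : ‖w + 2 * Real.pi * k * Complex.I - w‖ = 2 * Real.pi * k := by
        rw [add_sub_cancel_left]
        simp [abs_of_pos Real.pi_pos]
      rw [this, hL]
      have : (k : ℝ) < p + 1 := by exact_mod_cast k.2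
      gcongr
    choose τ hτ hτH using hpt
    have hinj : Function.Injective τ := by
      intro k l hkl
      have := (hτH k).symm.trans ((congrArg H hkl).trans (hτH l))
      have h2 := add_left_cancel this
      have h3 := mul_right_cancel₀ Complex.I_ne_zero h2
      have h4 := mul_left_cancel₀ (by simp [Real.pi_ne_zero]) h3
      exact Fin.ext (by exact_mod_cast h4)
    have := hp (h t₀ * Complex.exp (w - H t₀)) (univ.image τ) (by
      intro t ht
      obtain ⟨k, -, rfl⟩ := mem_image.1 ht
      refine ⟨hτ k, ?_⟩
      rw [hhH _ (hτ k), hτH k]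
      congr 1
      rw [Complex.exp_eq_exp_iff_exists_int]
      exact ⟨k, by push_cast; ring⟩)
    rw [card_image_of_injective _ hinj, card_univ, Fintype.card_fin] at this
    omega
  have hsub : ball t₀ r ⊆ ball t₀ (ρ / 4) := ball_subset_ball hr
  have hr0 : 0 < r := pos_of_mem_ball ht
  have hlip := (convex_ball t₀ r).norm_image_sub_le_of_norm_hasDerivWithin_le (f := H)
    (f' := deriv H) (C := 256 * L / ρ)
    (fun x hx => ((hH.differentiableAt (isOpen_ball.mem_nhds
      (ball_subset_ball (by linarith) hx))).hasDerivAt).hasDerivWithinAt)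
    (fun x hx => norm_deriv_le_of_not_ball_subset hρ hH hnot (hsub hx)) (mem_ball_self hr0) ht
  have hlt : 256 * L / ρ * ‖t - t₀‖ ≤ 256 * L / ρ * r := by
    gcongr
    exact (mem_ball_iff_norm.1 ht).le
  have htρ : t ∈ ball t₀ ρ := ball_subset_ball (by linarith) ht
  rw [hhH t htρ, mul_div_cancel_left₀ _ (h0 _ (mem_ball_self hρ))]
  refine (Complex.norm_exp_sub_one_le (by linarith)).trans ?_
  linarith

end Distortion
end FibInf

namespace FibInf

section Growth
open scoped Pointwise

/-- The powers of the subspace `W` of a `ℂ`-algebra have at most linearly growing dimension. -/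
def HasGrowth {A : Type*} [CommRing A] [Algebra ℂ A] (W : Submodule ℂ A) (C : ℕ) : Prop :=
  1 ∈ W ∧ ∀ m : ℕ, ∃ s : Finset A, s.card ≤ C * (m + 1) ∧ W ^ m ≤ Submodule.span ℂ (s : Set A)

variable {A : Type*} [CommRing A] [Algebra ℂ A] {W : Submodule ℂ A} {C : ℕ}

lemma HasGrowth.one_le (h : HasGrowth W C) : 1 ≤ W := Submodule.one_le.2 h.1

lemma pow_mem_of_le (hW : 1 ≤ W) {x : A} (hx : x ∈ W) {k e : ℕ} (h : k ≤ e) : x ^ k ∈ W ^ e :=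
  pow_le_pow_right' hW h (Submodule.pow_mem_pow W hx k)

lemma HasGrowth.pow (h : HasGrowth W C) {E : ℕ} (hE : 0 < E) : HasGrowth (W ^ E) (C * E) := by
  refine ⟨by simpa using pow_mem_of_le h.one_le h.1 (Nat.zero_le E), fun m => ?_⟩
  obtain ⟨s, hs, hW⟩ := h.2 (E * m)
  refine ⟨s, hs.trans ?_, by rwa [← pow_mul]⟩
  nlinarith [Nat.zero_le (C * (E - 1)), Nat.mul_le_mul_left C hE]

lemma HasGrowth.map {A' : Type*} [CommRing A'] [Algebra ℂ A'] (f : A →ₐ[ℂ] A')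
    (h : HasGrowth W C) : HasGrowth (W.map f.toLinearMap) C := by
  classical
  refine ⟨⟨1, h.1, map_one f⟩, fun m => ?_⟩
  obtain ⟨s, hs, hW⟩ := h.2 m
  refine ⟨s.image f, card_image_le.trans hs, ?_⟩
  rw [← Submodule.map_pow, coe_image]
  refine (Submodule.map_mono hW).trans ?_
  rw [Submodule.map_span]
  rfl

lemma HasGrowth.of_le_mul {W' : Submodule ℂ A} {d e : ℕ} (h : HasGrowth W C) (h1 : 1 ∈ W')
    (hK : ∀ m : ℕ, ∃ s : Finset A, s.card ≤ d ∧
      W' ^ m ≤ Submodule.span ℂ (s : Set A) * W ^ ((1 + e) * m)) :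
    HasGrowth W' (C * (d * (1 + e))) := by
  classical
  refine ⟨h1, fun m => ?_⟩
  obtain ⟨s, hs, hW⟩ := h.2 ((1 + e) * m)
  obtain ⟨s', hs', hW'⟩ := hK m
  refine ⟨s' * s, ?_, ?_⟩
  · refine (card_mul_le).trans ((Nat.mul_le_mul hs' hs).trans ?_)
    have : (1 + e) * m + 1 ≤ (1 + e) * (m + 1) := by nlinarith
    calc d * (C * ((1 + e) * m + 1)) ≤ d * (C * ((1 + e) * (m + 1))) := by gcongr
      _ = _ := by ring
  · rw [Finset.coe_mul, ← Submodule.span_mul_span]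
    exact hW'.trans (mul_le_mul' le_rfl hW)

/-- Adjoining an inverse. -/
lemma HasGrowth.adjoin_inv (h : HasGrowth W C) {u l : A} {e : ℕ} (hl : l ∈ W ^ e) (hul : u * l = 1) :
    ∃ W', W ≤ W' ∧ u ∈ W' ∧ HasGrowth W' (C * (1 + e)) := by
  refine ⟨Submodule.span ℂ {1, u} * W, ?_, ?_, ?_⟩
  · conv_lhs => rw [← one_mul W]
    refine mul_le_mul' (Submodule.one_le.2 (Submodule.subset_span (by simp))) le_rfl
  · have := Submodule.mul_mem_mul (M := Submodule.span ℂ {1, u}) (N := W) (m := u)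
      (Submodule.subset_span (by simp)) h.1
    simpa using this
  have hle : Submodule.span ℂ {1, u} * W ≤ Submodule.span ℂ {u} * W ^ (1 + e) := by
    rw [add_comm, pow_succ, ← mul_assoc]
    refine mul_le_mul' (Submodule.span_le.2 ?_) le_rfl
    rintro x (rfl | rfl)
    · rw [← hul]
      exact Submodule.mul_mem_mul (Submodule.mem_span_singleton_self _) hl
    · have := Submodule.mul_mem_mul (M := Submodule.span ℂ {x}) (N := W ^ e)
        (Submodule.mem_span_singleton_self x)
        (by simpa using pow_mem_of_le h.one_le h.1 (Nat.zero_le e) : (1 : A) ∈ W ^ e)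
      simpa using this
  have := HasGrowth.of_le_mul (W' := Submodule.span ℂ {1, u} * W) (d := 1) (e := e) h
    (by
      have := Submodule.mul_mem_mul (M := Submodule.span ℂ {1, u}) (N := W) (m := 1)
        (Submodule.subset_span (by simp)) h.1
      simpa using this)
    (fun m => ⟨{u ^ m}, by simp, by
      refine (pow_le_pow_left' hle m).trans ?_
      rw [mul_pow, ← pow_mul, Submodule.span_pow, Set.singleton_pow, coe_singleton]⟩)
  simpa using this

/-- Adjoining a root of a monic polynomial. -/
lemma HasGrowth.adjoin_root (h : HasGrowth W C) {b : A} {d e : ℕ} (hd : 0 < d) (a : ℕ → A)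
    (ha : ∀ i < d, a i ∈ W ^ e) (hb : b ^ d = ∑ i ∈ range d, a i * b ^ i) :
    ∃ W', W ≤ W' ∧ b ∈ W' ∧ HasGrowth W' (C * (d * (1 + e))) := by
  classical
  have h1 : (1 : A) ∈ Submodule.span ℂ {1, b} * W := by
    have := Submodule.mul_mem_mul (M := Submodule.span ℂ {1, b}) (N := W) (m := 1)
        (Submodule.subset_span (by simp)) h.1
    simpa using this
  refine ⟨Submodule.span ℂ {1, b} * W, ?_, ?_, ?_⟩
  · conv_lhs => rw [← one_mul W]
    refine mul_le_mul' (Submodule.one_le.2 (Submodule.subset_span (by simp))) le_rfl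
  · have := Submodule.mul_mem_mul (M := Submodule.span ℂ {1, b}) (N := W) (m := b)
      (Submodule.subset_span (by simp)) h.1
    simpa using this
  set s : Finset A := (range d).image (b ^ ·) with hs
  set K : Submodule ℂ A := Submodule.span ℂ (s : Set A) with hK
  have hbK : ∀ i < d, b ^ i ∈ K := fun i hi =>
    Submodule.subset_span (by simpa [hs] using ⟨i, hi, rfl⟩)
  have h1e : (1 : A) ∈ W ^ e := by simpa using pow_mem_of_le h.one_le h.1 (Nat.zero_le e)
  have hstep : Submodule.span ℂ {1, b} * K ≤ K * W ^ e := by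
    rw [hK, Submodule.span_mul_span, ← hK, Submodule.span_le]
    rintro _ ⟨x, hx, y, hy, rfl⟩
    obtain ⟨i, hi, rfl⟩ := mem_image.1 (mem_coe.1 hy)
    rw [mem_range] at hi
    rcases hx with rfl | rfl
    · have := Submodule.mul_mem_mul (hbK i hi) h1e
      simpa [mul_comm] using this
    · show x * x ^ i ∈ _
      rw [← pow_succ']
      rcases (Nat.succ_le_of_lt hi).lt_or_eq with hlt | heq
      · have := Submodule.mul_mem_mul (hbK _ hlt) h1e
        simpa using this
      · rw [Nat.succ_eq_add_one] at heq
        rw [heq, hb]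
        refine Submodule.sum_mem _ fun j hj => ?_
        have := Submodule.mul_mem_mul (hbK j (mem_range.1 hj)) (ha j (mem_range.1 hj))
        rwa [mul_comm (_ ^ j)] at this
  have hpow : ∀ m : ℕ, (Submodule.span ℂ {1, b} * W) ^ m * K ≤ K * W ^ ((1 + e) * m) := by
    intro m
    induction m with
    | zero => simp
    | succ m ih =>
      calc (Submodule.span ℂ {1, b} * W) ^ (m + 1) * K
          = (Submodule.span ℂ {1, b} * W) * ((Submodule.span ℂ {1, b} * W) ^ m * K) := by ring
        _ ≤ (Submodule.span ℂ {1, b} * W) * (K * W ^ ((1 + e) * m)) :=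
          mul_le_mul' le_rfl ih
        _ = (Submodule.span ℂ {1, b} * K) * W ^ ((1 + e) * m + 1) := by ring
        _ ≤ (K * W ^ e) * W ^ ((1 + e) * m + 1) := mul_le_mul' hstep le_rfl
        _ = _ := by ring
  refine HasGrowth.of_le_mul h h1 fun m => ⟨s, card_image_le.trans (by simp), ?_⟩
  refine le_trans ?_ (hpow m)
  conv_lhs => rw [← mul_one ((Submodule.span ℂ {1, b} * W) ^ m)]
  exact mul_le_mul' le_rfl (Submodule.one_le.2 (by simpa using hbK 0 hd))

/-- Adjoining finitely many roots of a monic polynomial. -/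
lemma HasGrowth.adjoin_roots (h : HasGrowth W C) {d e : ℕ} (a : ℕ → A)
    (ha : ∀ i < d, a i ∈ W ^ e) (b : Fin d → A)
    (hb : ∀ j, b j ^ d = ∑ i ∈ range d, a i * b j ^ i) :
    ∃ W', W ≤ W' ∧ (∀ j, b j ∈ W') ∧ HasGrowth W' (C * (d * (1 + e)) ^ d) := by
  classical
  have key : ∀ s : Finset (Fin d), ∃ W', W ≤ W' ∧ (∀ j ∈ s, b j ∈ W') ∧
      HasGrowth W' (C * (d * (1 + e)) ^ s.card) := by
    intro s
    induction s using Finset.induction_on with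
    | empty => exact ⟨W, le_rfl, by simp, by simpa using h⟩
    | insert j s hj ih =>
      obtain ⟨W₁, hW, hs, hg⟩ := ih
      obtain ⟨W₂, hW₂, hj₂, hg₂⟩ := hg.adjoin_root (b := b j) (e := e) (Fin.pos j) a
        (fun i hi => pow_le_pow_left' hW e (ha i hi)) (hb j)
      refine ⟨W₂, hW.trans hW₂, fun i hi => ?_, ?_⟩
      · rcases mem_insert.1 hi with rfl | hi
        · exact hj₂
        · exact hW₂ (hs i hi)
      · rwa [card_insert_of_notMem hj, pow_succ, ← mul_assoc]
  obtain ⟨W', h1, h2, h3⟩ := key univ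
  exact ⟨W', h1, fun j => h2 j (mem_univ j), by simpa using h3⟩

/-- Two elements of a subspace of linear growth are algebraically dependent. -/
lemma HasGrowth.exists_relation (h : HasGrowth W C) {x y : A} (hx : x ∈ W) (hy : y ∈ W) :
    ∃ P : Polynomial (Polynomial ℂ), P ≠ 0 ∧ P.natDegree ≤ 2 * C ∧
      P.eval₂ (Polynomial.aeval y).toRingHom x = 0 := by
  classical
  set n := 2 * C with hn
  obtain ⟨s, hs, hW⟩ := h.2 (n + n)
  have hv : ∀ i : Fin (n + 1) × Fin (n + 1), x ^ (i.1 : ℕ) * y ^ (i.2 : ℕ) ∈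
      Submodule.span ℂ (s : Set A) := fun i => by
    refine hW ?_
    rw [pow_add]
    exact Submodule.mul_mem_mul (pow_mem_of_le h.one_le hx (Nat.lt_succ_iff.1 i.1.2))
      (pow_mem_of_le h.one_le hy (Nat.lt_succ_iff.1 i.2.2))
  let v : Fin (n + 1) × Fin (n + 1) → Submodule.span ℂ (s : Set A) := fun i => ⟨_, hv i⟩
  have hdep : ¬ LinearIndependent ℂ v := by
    intro hli
    have h1 := hli.fintype_card_le_finrank
    have h2 : Module.finrank ℂ (Submodule.span ℂ (s : Set A)) ≤ s.card :=
      finrank_span_finset_le_card s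
    rw [Fintype.card_prod, Fintype.card_fin] at h1
    have h3 := h1.trans (h2.trans hs)
    rw [hn] at h3
    nlinarith
  obtain ⟨g, hg, ⟨i₀, j₀⟩, hne⟩ := Fintype.not_linearIndependent_iff.1 hdep
  refine ⟨∑ i, Polynomial.monomial (i : Fin (n + 1) × Fin (n + 1)).1
    (Polynomial.monomial i.2 (g i)), ?_, ?_, ?_⟩
  · intro h0
    refine hne ?_
    have := congrArg (fun p => (Polynomial.coeff p i₀).coeff j₀) h0
    simp only [Polynomial.finsetSum_coeff, Polynomial.coeff_monomial, Polynomial.coeff_zero] at this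
    rw [Finset.sum_eq_single (i₀, j₀)] at this
    · simpa using this
    · rintro ⟨i, j⟩ - hij
      by_cases h1 : (i : ℕ) = i₀
      · have h2 : (j : ℕ) ≠ j₀ := fun h2 => hij (Prod.ext (Fin.ext h1) (Fin.ext h2))
        simp [h1, Polynomial.coeff_monomial, h2]
      · simp [h1]
    · simp
  · refine Polynomial.natDegree_sum_le_of_forall_le _ _ fun i _ => ?_
    exact (Polynomial.natDegree_monomial_le _).trans (Nat.lt_succ_iff.1 i.1.2)
  · have := congrArg (Subtype.val) hg
    rw [Submodule.coe_sum] at this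
    rw [Polynomial.eval₂_finsetSum]
    refine Eq.trans (Finset.sum_congr rfl fun i _ => ?_) this
    simp [Polynomial.eval₂_monomial, v, Algebra.smul_def]
    ring

end Growth
end FibInf

namespace FibInf

section Valence
open Filter Topology Metric

lemma eval_pi_eval₂ {B : Type*} (x y : B → ℂ) (P : Polynomial (Polynomial ℂ)) (t : B) :
    P.eval₂ (Polynomial.aeval y).toRingHom x t =
      P.eval₂ (Polynomial.evalRingHom (y t)) (x t) := by
  have h := Polynomial.hom_eval₂ P (Polynomial.aeval y).toRingHom (Pi.evalRingHom (fun _ : B => ℂ) t) x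
  refine h.trans ?_
  congr 1
  ext c
  · simp
  · simp

lemma differentiableOn_eval₂ {U : Set ℂ} {h : ℂ → ℂ} (hd : DifferentiableOn ℂ h U)
    (P : Polynomial (Polynomial ℂ)) :
    DifferentiableOn ℂ (fun t => P.eval₂ (Polynomial.evalRingHom (h t)) t) U := by
  simp only [Polynomial.eval₂_eq_sum_range]
  refine DifferentiableOn.fun_sum fun i _ => DifferentiableOn.mul ?_ (differentiableOn_id.pow i)
  exact (P.coeff i).differentiable.comp_differentiableOn hd

/-- A non-constant holomorphic function in a subspace of linear growth takes each value boundedly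
many times. -/
lemma card_le_of_hasGrowth {t₀ : ℂ} {ρ : ℝ} {W : Submodule ℂ (ball t₀ ρ → ℂ)}
    {C : ℕ} (hW : HasGrowth W C) (hT : (fun t : ball t₀ ρ => (t : ℂ)) ∈ W) {h : ℂ → ℂ}
    (hd : DifferentiableOn ℂ h (ball t₀ ρ)) (hh : (fun t : ball t₀ ρ => h t) ∈ W)
    (hnc : ¬ ∀ t ∈ ball t₀ ρ, h t = h t₀) (y : ℂ) (s : Finset ℂ)
    (hs : ∀ t ∈ s, t ∈ ball t₀ ρ ∧ h t = y) : s.card ≤ 2 * C := by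
  classical
  let : NormalizedGCDMonoid (Polynomial ℂ) :=
    UniqueFactorizationMonoid.toNormalizedGCDMonoid (Polynomial ℂ)
  obtain ⟨P, hP0, hPd, hP⟩ := hW.exists_relation hT hh
  have hP' : ∀ t ∈ ball t₀ ρ, P.eval₂ (Polynomial.evalRingHom (h t)) t = 0 := fun t ht => by
    have := congrFun hP ⟨t, ht⟩
    rwa [eval_pi_eval₂] at this
  have hpc := (convex_ball t₀ ρ).isPreconnected
  have hcon : P.content ≠ 0 := by rwa [Ne, Polynomial.content_eq_zero_iff]
  have hprod : ∀ t ∈ ball t₀ ρ, (P.content).eval (h t) *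
      P.primPart.eval₂ (Polynomial.evalRingHom (h t)) t = 0 := fun t ht => by
    rw [← hP' t ht]
    conv_rhs => rw [P.eq_C_content_mul_primPart]
    rw [Polynomial.eval₂_mul, Polynomial.eval₂_C, Polynomial.coe_evalRingHom]
  rcases AnalyticOnNhd.eq_zero_or_eq_zero_of_mul_eq_zero
    ((P.content.differentiable.comp_differentiableOn hd).analyticOnNhd isOpen_ball)
    ((differentiableOn_eval₂ hd P.primPart).analyticOnNhd isOpen_ball) hprod hpc with h1 | h1
  · refine absurd (fun t ht => ?_) hnc
    have ht₀ : t₀ ∈ ball t₀ ρ := mem_ball_self (pos_of_mem_ball ht)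
    exact hpc.constant_of_mapsTo (T := (P.content.roots.toFinset : Set ℂ))
      (Set.toFinite _).isDiscrete hd.continuousOn
      (fun u hu => by simpa [hcon] using h1 u hu) ht ht₀
  · set q := P.primPart.map (Polynomial.evalRingHom y) with hq
    have hq0 : q ≠ 0 := by
      intro hq0
      have hdvd : Polynomial.C (Polynomial.X - Polynomial.C y) ∣ P.primPart := by
        rw [Polynomial.C_dvd_iff_dvd_coeff]
        intro i
        rw [Polynomial.dvd_iff_isRoot]
        have := congrArg (fun p => Polynomial.coeff p i) hq0
        simpa [hq, Polynomial.coeff_map] using this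
      exact Polynomial.not_isUnit_X_sub_C y (P.isPrimitive_primPart _ hdvd)
    have hsub : s ⊆ q.roots.toFinset := fun t ht => by
      obtain ⟨htB, hty⟩ := hs t ht
      have := h1 t htB
      rw [hty] at this
      rwa [Multiset.mem_toFinset, Polynomial.mem_roots hq0, Polynomial.IsRoot.def, hq,
        Polynomial.eval_map]
    calc s.card ≤ q.roots.toFinset.card := card_le_card hsub
      _ ≤ q.roots.card := Multiset.toFinset_card_le _
      _ ≤ q.natDegree := q.card_roots'
      _ ≤ P.primPart.natDegree := Polynomial.natDegree_map_le
      _ ≤ 2 * C := by rw [Polynomial.natDegree_primPart]; exact hPd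

/-- Nowhere vanishing holomorphic functions in subspaces of bounded linear growth have uniformly
small distortion near the centre. -/
lemma exists_radius_distortion {ρ : ℝ} (hρ : 0 < ρ) (C : ℕ) {ε : ℝ} (hε : 0 < ε) :
    ∃ r, 0 < r ∧ r ≤ ρ / 4 ∧ ∀ (t₀ : ℂ) (W : Submodule ℂ (ball t₀ ρ → ℂ)), HasGrowth W C →
      (fun t : ball t₀ ρ => (t : ℂ)) ∈ W → ∀ h : ℂ → ℂ, DifferentiableOn ℂ h (ball t₀ ρ) →
      (fun t : ball t₀ ρ => h t) ∈ W → (∀ t ∈ ball t₀ ρ, h t ≠ 0) →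
      ∀ t ∈ ball t₀ r, ‖h t - h t₀‖ ≤ ε * ‖h t₀‖ := by
  set K := 256 * (2 * Real.pi * ((2 * C : ℕ) + 1)) / ρ with hK
  have hKpos : 0 < K := by positivity
  set r := min (ρ / 4) (min (1 / K) (ε / (2 * K))) with hr
  have hr0 : 0 < r := by positivity
  have hr1 : r ≤ ρ / 4 := min_le_left _ _
  have hr2 : K * r ≤ 1 := by
    have : r ≤ 1 / K := (min_le_right _ _).trans (min_le_left _ _)
    rwa [le_div_iff₀' hKpos] at this
  have hr3 : 2 * (K * r) ≤ ε := by
    have : r ≤ ε / (2 * K) := (min_le_right _ _).trans (min_le_right _ _)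
    rw [le_div_iff₀' (by positivity)] at this
    linarith
  refine ⟨r, hr0, hr1, fun t₀ W hW hT h hd hh h0 t ht => ?_⟩
  have hnz := h0 t₀ (mem_ball_self hρ)
  by_cases hnc : ∀ t ∈ ball t₀ ρ, h t = h t₀
  · rw [hnc t (ball_subset_ball (by linarith) ht), sub_self, norm_zero]
    positivity
  · have := norm_div_sub_one_le hρ hd h0 (card_le_of_hasGrowth hW hT hd hh hnc) hr1 hr2 ht
    have e : h t - h t₀ = (h t / h t₀ - 1) * h t₀ := by field_simp
    rw [e, norm_mul]
    gcongr
    exact this.trans hr3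

end Valence
end FibInf

namespace FibInf

section Uniqueness
open Filter Topology Metric

lemma exists_perm_of_map_eq {ι α : Type*} [Fintype ι] {f g : ι → α}
    (h : (univ : Finset ι).val.map f = (univ : Finset ι).val.map g) :
    ∃ σ : Equiv.Perm ι, ∀ i, f (σ i) = g i := by
  classical
  have hc : ∀ y, Nonempty ({i // g i = y} ≃ {i // f i = y}) := fun y => by
    refine Fintype.card_eq.1 ?_
    have := congrArg (Multiset.count y) h
    rw [Multiset.count_map, Multiset.count_map] at this
    rw [Fintype.card_subtype, Fintype.card_subtype]
    simp only [eq_comm (a := y)] at this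
    exact this.symm
  let e := fun y => (hc y).some
  refine ⟨(Equiv.sigmaFiberEquiv g).symm.trans
    ((Equiv.sigmaCongrRight e).trans (Equiv.sigmaFiberEquiv f)), fun i => ?_⟩
  exact (e (g i) ⟨i, rfl⟩).2

lemma exists_perm_of_prod_eq {d : ℕ} {f g : Fin d → ℂ}
    (h : ∏ j, (Polynomial.X - Polynomial.C (f j)) = ∏ j, (Polynomial.X - Polynomial.C (g j))) :
    ∃ σ : Equiv.Perm (Fin d), ∀ i, f (σ i) = g i := by
  refine exists_perm_of_map_eq ?_
  have e : ∀ f : Fin d → ℂ, (∏ j, (Polynomial.X - Polynomial.C (f j))).roots = univ.val.map f := by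
    intro f
    have := Polynomial.roots_multiset_prod_X_sub_C (univ.val.map f)
    rwa [Multiset.map_map] at this
  rw [← e f, ← e g, h]

/-- Continuous root functions of a family of polynomials over a connected set are unique up to a
permutation. -/
lemma exists_perm_of_continuousOn {B : Set ℂ} (hB : IsPreconnected B) {t₀ : ℂ} (ht₀ : t₀ ∈ B) {d : ℕ}
    {b β : Fin d → ℂ → ℂ} (hb : ∀ j, ContinuousOn (b j) B) (hβ : ∀ j, ContinuousOn (β j) B)
    (hdich : ∀ i j, (∀ t ∈ B, b i t = b j t) ∨ ∀ t ∈ B, b i t ≠ b j t)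
    (h : ∀ t ∈ B, ∏ j, (Polynomial.X - Polynomial.C (β j t)) =
      ∏ j, (Polynomial.X - Polynomial.C (b j t))) :
    ∃ σ : Equiv.Perm (Fin d), ∀ j, ∀ t ∈ B, β j t = b (σ j) t := by
  obtain ⟨σ, hσ⟩ := exists_perm_of_prod_eq (h t₀ ht₀).symm
  refine ⟨σ, fun j t ht => ?_⟩
  have : PreconnectedSpace B := isPreconnected_iff_preconnectedSpace.1 hB
  have hcl : ∀ k, IsClosed {t : B | β j t = b k t} := fun k =>
    isClosed_eq (hβ j).domRestrict (hb k).domRestrict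
  have hcompl : {t : B | β j t = b (σ j) t}ᶜ =
      ⋃ k ∈ {k | ∀ t ∈ B, b k t ≠ b (σ j) t}, {t : B | β j t = b k t} := by
    ext t
    simp only [Set.mem_compl_iff, Set.mem_ofPred_eq, Set.mem_iUnion, exists_prop]
    constructor
    · intro hne
      have hroot : (∏ k, (Polynomial.X - Polynomial.C (b k t))).eval (β j t) = 0 := by
        rw [← h t t.2, Polynomial.eval_prod]
        exact prod_eq_zero (mem_univ j) (by simp)
      rw [Polynomial.eval_prod, prod_eq_zero_iff] at hroot
      obtain ⟨k, -, hk⟩ := hroot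
      have hk' : β j t = b k t := by simpa [sub_eq_zero] using hk
      refine ⟨k, (hdich k (σ j)).resolve_left fun he => hne ?_, hk'⟩
      rw [hk', he t t.2]
    · rintro ⟨k, hk, hk'⟩ he
      exact hk t t.2 (hk'.symm.trans he)
  have hclopen : IsClopen {t : B | β j t = b (σ j) t} := by
    refine ⟨hcl _, ?_⟩
    rw [← isClosed_compl_iff, hcompl]
    exact Set.Finite.isClosed_biUnion (Set.toFinite _) fun k _ => hcl k
  have := hclopen.eq_univ ⟨⟨t₀, ht₀⟩, (hσ j).symm⟩
  exact (this.symm ▸ Set.mem_univ _ : (⟨t, ht⟩ : B) ∈ {t : B | β j t = b (σ j) t})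

end Uniqueness

section RootContinuity
open Filter Topology Metric

lemma norm_le_of_isRoot {p : Polynomial ℂ} {d : ℕ} (hp : p.Monic) (hd : p.natDegree = d) {w : ℂ}
    (hw : p.IsRoot w) : ‖w‖ ≤ 1 + ∑ i ∈ range d, ‖p.coeff i‖ := by
  have hS : 0 ≤ ∑ i ∈ range d, ‖p.coeff i‖ := sum_nonneg fun _ _ => norm_nonneg _
  by_contra! hlt
  have h1 : 1 < ‖w‖ := by linarith
  have hd0 : 0 < d := by
    rcases Nat.eq_zero_or_pos d with h0 | h0
    · have : p = 1 := hp.natDegree_eq_zero.1 (hd.trans h0)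
      simp [this] at hw
    · exact h0
  have hev : w ^ d = - ∑ i ∈ range d, p.coeff i * w ^ i := by
    have := hw.eq_zero
    rw [Polynomial.eval_eq_sum_range, hd, sum_range_succ, ← hd, hp.coeff_natDegree, one_mul] at this
    rw [← hd]
    linear_combination this
  have h2 : ‖w‖ ^ d ≤ (∑ i ∈ range d, ‖p.coeff i‖) * ‖w‖ ^ (d - 1) := by
    rw [← norm_pow, hev, norm_neg, sum_mul]
    refine (norm_sum_le _ _).trans (sum_le_sum fun i hi => ?_)
    rw [norm_mul, norm_pow]
    have := mem_range.1 hi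
    gcongr
    · exact h1.le
    · omega
  have h3 : ‖w‖ ^ d = ‖w‖ * ‖w‖ ^ (d - 1) := by rw [← pow_succ', Nat.sub_add_cancel hd0]
  rw [h3] at h2
  have := le_of_mul_le_mul_right h2 (by positivity)
  linarith

lemma norm_sub_le_of_norm_le {f : ℂ → ℂ} {t : ℂ} {s M : ℝ} (hs : 0 < s)
    (hf : DifferentiableOn ℂ f (ball t (2 * s))) (hM : ∀ u ∈ ball t (2 * s), ‖f u‖ ≤ M)
    {u v : ℂ} (hu : u ∈ ball t (s / 2)) (hv : v ∈ ball t (s / 2)) :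
    ‖f u - f v‖ ≤ 2 * M / s * ‖u - v‖ := by
  have hsub : ball v s ⊆ ball t (2 * s) := by
    refine ball_subset_ball' ?_
    rw [mem_ball] at hv
    linarith
  have hv' : v ∈ ball t (2 * s) := hsub (mem_ball_self hs)
  have huv : u ∈ ball v s := by
    rw [mem_ball] at *
    linarith [dist_triangle_right u v t]
  have := Complex.dist_le_div_mul_dist_of_mapsTo_ball (hf.mono hsub) (R₂ := 2 * M) (by
    intro x hx
    rw [mem_closedBall, dist_eq_norm]
    linarith [norm_sub_le (f x) (f v), hM x (hsub hx), hM v hv']) huv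
  rwa [dist_eq_norm, dist_eq_norm] at this

variable {Z : Type*} [TopologicalSpace Z] {B : Set ℂ} {d : ℕ} {q : ℂ → Z → Polynomial ℂ}
  {b : Z → Fin d → ℂ → ℂ}

lemma eventually_lipschitz_roots (hB : IsOpen B)
    (hb : ∀ z j, DifferentiableOn ℂ (b z j) B)
    (hq : ∀ z, ∀ t ∈ B, q t z = ∏ j, (Polynomial.X - Polynomial.C (b z j t)))
    (hc : ∀ k, ContinuousOn (fun p : ℂ × Z => (q p.1 p.2).coeff k) (B ×ˢ Set.univ))
    {t₁ : ℂ} (ht₁ : t₁ ∈ B) (z₁ : Z) :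
    ∃ s > 0, ∃ K : ℝ, ball t₁ s ⊆ B ∧ ∀ᶠ z in 𝓝 z₁, ∀ j, ∀ u ∈ ball t₁ s, ‖b z j u‖ ≤ K ∧
      ∀ v ∈ ball t₁ s, ‖b z j u - b z j v‖ ≤ K * ‖u - v‖ := by
  have hcS : ContinuousOn (fun p : ℂ × Z => 1 + ∑ i ∈ range d, ‖(q p.1 p.2).coeff i‖)
      (B ×ˢ Set.univ) :=
    continuousOn_const.add (continuousOn_finsetSum _ fun i _ => (hc i).norm)
  have hat : ContinuousAt (fun p : ℂ × Z => 1 + ∑ i ∈ range d, ‖(q p.1 p.2).coeff i‖) (t₁, z₁) :=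
    hcS.continuousAt (prod_mem_nhds (hB.mem_nhds ht₁) univ_mem)
  set M := 1 + ∑ i ∈ range d, ‖(q t₁ z₁).coeff i‖ + 1 with hM
  have hev : ∀ᶠ p in 𝓝 t₁ ×ˢ 𝓝 z₁, 1 + ∑ i ∈ range d, ‖(q p.1 p.2).coeff i‖ < M := by
    rw [← nhds_prod_eq]
    exact hat.eventually (gt_mem_nhds (by simp [hM]))
  obtain ⟨pa, hpa, pb, hpb, hab⟩ := eventually_prod_iff.1 hev
  obtain ⟨s, hs, hsB⟩ := Metric.mem_nhds_iff.1 (inter_mem (hB.mem_nhds ht₁) hpa)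
  have hM0 : 0 ≤ M := by positivity
  refine ⟨s / 4, by positivity, max M (2 * M / (s / 2)),
    (ball_subset_ball (by linarith)).trans fun x hx => (hsB hx).1, ?_⟩
  have hsB' : ball t₁ (2 * (s / 2)) ⊆ B := by
    rw [mul_div_cancel₀ _ two_ne_zero]
    exact fun x hx => (hsB hx).1
  filter_upwards [hpb] with z hz j
  have hbd : ∀ u ∈ ball t₁ (2 * (s / 2)), ‖b z j u‖ ≤ M := by
    intro u hu
    have hu' := hu
    rw [mul_div_cancel₀ _ two_ne_zero] at hu'
    have huB := hsB' hu
    have hmon : (q u z).Monic := by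
      rw [hq z u huB]
      exact Polynomial.monic_prod_of_monic _ _ fun j _ => Polynomial.monic_X_sub_C _
    refine (norm_le_of_isRoot (p := q u z) (d := d) hmon ?_ ?_).trans (hab (hsB hu').2 hz).le
    · rw [hq z u huB, Polynomial.natDegree_prod_of_monic _ _ fun j _ => Polynomial.monic_X_sub_C _]
      simp
    · rw [Polynomial.IsRoot.def, hq z u huB, Polynomial.eval_prod]
      exact prod_eq_zero (mem_univ j) (by simp)
  refine fun u hu => ⟨(hbd u (ball_subset_ball (by linarith) hu)).trans (le_max_left _ _),
    fun v hv => ?_⟩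
  have e : s / 4 = s / 2 / 2 := by ring
  rw [e] at hu hv
  refine (norm_sub_le_of_norm_le (by positivity) ((hb z j).mono hsB') hbd hu hv).trans ?_
  gcongr
  exact le_max_right _ _

/-- The interpolated displacement of the roots depends continuously on all the data. -/
lemma continuousOn_interp_roots (hB : IsOpen B) (hBc : IsPreconnected B) {t₀ : ℂ} (ht₀ : t₀ ∈ B)
    (hb : ∀ z j, DifferentiableOn ℂ (b z j) B)
    (hq : ∀ z, ∀ t ∈ B, q t z = ∏ j, (Polynomial.X - Polynomial.C (b z j t)))
    (hc : ∀ k, ContinuousOn (fun p : ℂ × Z => (q p.1 p.2).coeff k) (B ×ˢ Set.univ))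
    (hdich : ∀ z i j, (∀ t ∈ B, b z i t = b z j t) ∨ ∀ t ∈ B, b z i t ≠ b z j t)
    {ε : ℝ} (hε : 0 ≤ ε) (hsep : ∀ z, ∀ t ∈ B, ∀ i j,
      ‖(b z i t - b z i t₀) - (b z j t - b z j t₀)‖ ≤ ε * ‖b z i t₀ - b z j t₀‖) :
    ContinuousOn (fun p : ℂ × Z × ℂ => interp (fun j => b p.2.1 j t₀)
      (fun j => b p.2.1 j p.1 - b p.2.1 j t₀) p.2.2) (B ×ˢ Set.univ) := by
  rintro ⟨t₁, z₁, w₁⟩ ⟨ht₁, -⟩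
  replace ht₁ : t₁ ∈ B := ht₁
  refine ContinuousAt.continuousWithinAt ?_
  rw [ContinuousAt, tendsto_iff_ultrafilter]
  intro g hg
  have hgt : Tendsto (fun p : ℂ × Z × ℂ => p.1) g (𝓝 t₁) :=
    (continuous_fst.tendsto (t₁, z₁, w₁)).mono_left hg
  have hgz : Tendsto (fun p : ℂ × Z × ℂ => p.2.1) g (𝓝 z₁) :=
    ((continuous_fst.comp continuous_snd).tendsto (t₁, z₁, w₁)).mono_left hg
  have hgw : Tendsto (fun p : ℂ × Z × ℂ => p.2.2) g (𝓝 w₁) :=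
    ((continuous_snd.comp continuous_snd).tendsto (t₁, z₁, w₁)).mono_left hg
  have hlim : ∀ j t, ∃ y, t ∈ B → Tendsto (fun p : ℂ × Z × ℂ => b p.2.1 j t) g (𝓝 y) := by
    intro j t
    by_cases ht : t ∈ B
    · obtain ⟨s, hs, K, -, hev⟩ := eventually_lipschitz_roots hB hb hq hc ht z₁
      have hmem : ∀ᶠ p in (g : Filter (ℂ × Z × ℂ)), b p.2.1 j t ∈ closedBall (0 : ℂ) K := by
        filter_upwards [hgz.eventually hev] with p hp
        simpa using (hp j t (mem_ball_self hs)).1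
      obtain ⟨y, -, hy⟩ := (isCompact_closedBall (0 : ℂ) K).ultrafilter_le_nhds'
        (g.map fun p : ℂ × Z × ℂ => b p.2.1 j t) hmem
      exact ⟨y, fun _ => hy⟩
    · exact ⟨0, fun h => (ht h).elim⟩
  choose β hβ using hlim
  have hβc : ∀ j, ContinuousOn (β j) B := by
    intro j t₂ ht₂
    obtain ⟨s, hs, K, hsB, hev⟩ := eventually_lipschitz_roots hB hb hq hc ht₂ z₁
    have hl : ∀ u ∈ ball t₂ s, ‖β j u - β j t₂‖ ≤ K * ‖u - t₂‖ := by
      intro u hu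
      refine le_of_tendsto ((hβ j u (hsB hu)).sub (hβ j t₂ ht₂)).norm ?_
      filter_upwards [hgz.eventually hev] with p hp
      exact (hp j u hu).2 t₂ (mem_ball_self hs)
    refine ContinuousAt.continuousWithinAt ?_
    rw [ContinuousAt, tendsto_iff_norm_sub_tendsto_zero]
    refine squeeze_zero' (Eventually.of_forall fun _ => norm_nonneg _)
      (mem_of_superset (ball_mem_nhds t₂ hs) hl) ?_
    have : Continuous fun u : ℂ => K * ‖u - t₂‖ := by fun_prop
    simpa using this.tendsto t₂
  have hprod : ∀ t ∈ B, ∏ j, (Polynomial.X - Polynomial.C (β j t)) =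
      ∏ j, (Polynomial.X - Polynomial.C (b z₁ j t)) := by
    intro t ht
    refine Polynomial.funext fun x => ?_
    have h1 : Tendsto (fun p : ℂ × Z × ℂ => (q t p.2.1).eval x) g
        (𝓝 (∏ j, (x - β j t))) := by
      have := tendsto_finsetProd univ fun j _ =>
        (tendsto_const_nhds (x := x)).sub (hβ j t ht)
      refine this.congr fun p => ?_
      simp [hq _ t ht, Polynomial.eval_prod]
    have hev : ∀ z, (q t z).eval x = ∑ i ∈ range (d + 1), (q t z).coeff i * x ^ i := fun z => by
      refine Polynomial.eval_eq_sum_range' (Nat.lt_succ_of_le ?_) _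
      rw [hq z t ht, Polynomial.natDegree_prod_of_monic _ _ fun j _ => Polynomial.monic_X_sub_C _]
      simp
    have h2 : Tendsto (fun p : ℂ × Z × ℂ => (q t p.2.1).eval x) g (𝓝 ((q t z₁).eval x)) := by
      simp only [hev]
      refine tendsto_finsetSum _ fun i _ => Tendsto.mul_const _ ?_
      have : ContinuousAt (fun p : ℂ × Z => (q p.1 p.2).coeff i) (t, z₁) :=
        (hc i).continuousAt (prod_mem_nhds (hB.mem_nhds ht) univ_mem)
      exact this.tendsto.comp (tendsto_const_nhds.prodMk_nhds hgz)
    rw [← hq z₁ t ht, ← tendsto_nhds_unique h1 h2]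
    simp [Polynomial.eval_prod]
  obtain ⟨σ, hσ⟩ := exists_perm_of_continuousOn hBc ht₀ (fun j => (hb z₁ j).continuousOn) hβc
    (hdich z₁) hprod
  have ha : ∀ j, Tendsto (fun p : ℂ × Z × ℂ => b p.2.1 j t₀) g (𝓝 (b z₁ (σ j) t₀)) := fun j => by
    rw [← hσ j t₀ ht₀]
    exact hβ j t₀ ht₀
  have hb₁ : ∀ j, Tendsto (fun p : ℂ × Z × ℂ => b p.2.1 j p.1) g (𝓝 (b z₁ (σ j) t₁)) := fun j => by
    rw [← hσ j t₁ ht₁]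
    obtain ⟨s, hs, K, hsB, hev⟩ := eventually_lipschitz_roots hB hb hq hc ht₁ z₁
    have h0 : Tendsto (fun p : ℂ × Z × ℂ => b p.2.1 j p.1 - b p.2.1 j t₁) g (𝓝 0) := by
      have : Tendsto (fun p : ℂ × Z × ℂ => K * ‖p.1 - t₁‖) g (𝓝 0) := by
        have := ((hgt.sub_const t₁).norm).const_mul K
        simpa using this
      refine squeeze_zero_norm' ?_ this
      filter_upwards [hgz.eventually hev, hgt.eventually (ball_mem_nhds t₁ hs)] with p hp hp'
      exact (hp j p.1 hp').2 t₁ (mem_ball_self hs)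
    simpa using h0.add (hβ j t₁ ht₁)
  have key := tendsto_interp (l := (g : Filter (ℂ × Z × ℂ))) (a := fun p j => b p.2.1 j t₀)
    (δ := fun p j => b p.2.1 j p.1 - b p.2.1 j t₀) (w := fun p => p.2.2)
    (a₀ := fun j => b z₁ (σ j) t₀) (δ₀ := fun j => b z₁ (σ j) t₁ - b z₁ (σ j) t₀) hε
    (by filter_upwards [hgt.eventually (hB.mem_nhds ht₁)] with p hp using hsep _ _ hp)
    (fun i j => hsep z₁ t₁ ht₁ (σ i) (σ j)) ha (fun j => (hb₁ j).sub (ha j)) hgw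
  have e := interp_comp_perm (a := fun j => b z₁ j t₀) (δ := fun j => b z₁ j t₁ - b z₁ j t₀)
    (eq_of_norm_sub_le (hsep z₁ t₁ ht₁)) σ w₁
  refine key.trans_eq ?_
  exact congrArg 𝓝 e

end RootContinuity
end FibInf

namespace FibInf
open Filter Topology Metric

lemma exists_inverse_add_contraction {X : Type*} [TopologicalSpace X] {s : Set X} {g : X → ℂ → ℂ}
    (hg : ContinuousOn (fun p : X × ℂ => g p.1 p.2) (s ×ˢ Set.univ))
    (hlip : ∀ x ∈ s, ∀ w w', ‖g x w - g x w'‖ ≤ 1 / 2 * ‖w - w'‖) :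
    ∃ G : X → ℂ → ℂ, (∀ x ∈ s, ∀ y, G x y + g x (G x y) = y) ∧
      (∀ x ∈ s, ∀ w, G x (w + g x w) = w) ∧
      ContinuousOn (fun p : X × ℂ => G p.1 p.2) (s ×ˢ Set.univ) := by
  classical
  have hex : ∀ x y, ∃ w, x ∈ s → w + g x w = y := fun x y => by
    by_cases hx : x ∈ s
    · have hK : ContractingWith (1 / 2) (fun w => y - g x w) := by
        refine ⟨by rw [← NNReal.coe_lt_coe]; norm_num, LipschitzWith.of_dist_le_mul fun w w' => ?_⟩
        rw [dist_eq_norm, dist_eq_norm, sub_sub_sub_cancel_left, norm_sub_rev]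
        simpa using hlip x hx w w'
      exact ⟨_, fun _ => by
        have h := hK.fixedPoint_isFixedPt
        rw [Function.IsFixedPt, sub_eq_iff_eq_add] at h
        exact h.symm⟩
    · exact ⟨0, fun h => absurd h hx⟩
  choose G hG using hex
  have hest : ∀ x ∈ s, ∀ w w', ‖w - w'‖ ≤ 2 * ‖(w + g x w) - (w' + g x w')‖ := by
    intro x hx w w'
    have h1 := hlip x hx w w'
    have h2 : ‖w - w'‖ ≤ ‖(w + g x w) - (w' + g x w')‖ + ‖g x w - g x w'‖ := by
      refine le_trans (le_of_eq ?_) (norm_sub_le _ _)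
      congr 1
      ring
    linarith
  refine ⟨G, fun x hx y => hG x y hx, fun x hx w => ?_, ?_⟩
  · have := hest x hx (G x (w + g x w)) w
    rw [hG _ _ hx, sub_self, norm_zero, mul_zero] at this
    exact sub_eq_zero.1 (norm_le_zero_iff.1 this)
  · rintro ⟨x₀, y₀⟩ ⟨hx₀, -⟩
    set w₁ := G x₀ y₀ with hw₁
    have hg' : ContinuousOn (fun p : X × ℂ => g p.1 w₁) (s ×ˢ Set.univ) :=
      hg.comp (f := fun p : X × ℂ => (p.1, w₁)) (by fun_prop) fun p hp => ⟨hp.1, Set.mem_univ _⟩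
    have hc : ContinuousOn (fun p : X × ℂ => 2 * ‖p.2 - (w₁ + g p.1 w₁)‖) (s ×ˢ Set.univ) :=
      continuousOn_const.mul (continuous_snd.continuousOn.sub (continuousOn_const.add hg')).norm
    have hlim := hc (x₀, y₀) ⟨hx₀, Set.mem_univ _⟩
    rw [ContinuousWithinAt, hw₁, hG x₀ y₀ hx₀, sub_self, norm_zero, mul_zero, ← hw₁] at hlim
    refine tendsto_iff_norm_sub_tendsto_zero.2 (squeeze_zero' (.of_forall fun _ => norm_nonneg _)
      ?_ hlim)
    filter_upwards [self_mem_nhdsWithin] with p hp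
    have := hest p.1 hp.1 (G p.1 p.2) w₁
    rwa [hG _ _ hp.1] at this

/-- Evaluation of a polynomial with coefficients in `ℂ[t]` at a parameter and a point. -/
def evalAt {n : ℕ} (t : ℂ) (x : Fin n → ℂ) : MvPolynomial (Fin n) (Polynomial ℂ) →+* ℂ :=
  eval₂Hom (Polynomial.evalRingHom t) x

variable {n : ℕ}

lemma continuous_evalAt (p : MvPolynomial (Fin n) (Polynomial ℂ)) :
    Continuous fun a : ℂ × (Fin n → ℂ) => evalAt a.1 a.2 p := by
  induction p using MvPolynomial.induction_on with
  | C a => simpa [evalAt, Function.comp_def] using a.continuous.comp continuous_fst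
  | add p q hp hq => simpa using hp.fun_add hq
  | mul_X p i hp =>
    simp only [map_mul]
    refine hp.mul ?_
    simp only [evalAt, coe_eval₂Hom, eval₂_X]
    fun_prop

lemma differentiableOn_evalAt {s : Set ℂ} {φ : ℂ → Fin n → ℂ}
    (hφ : ∀ k, DifferentiableOn ℂ (fun t => φ t k) s) (p : MvPolynomial (Fin n) (Polynomial ℂ)) :
    DifferentiableOn ℂ (fun t => evalAt t (φ t) p) s := by
  induction p using MvPolynomial.induction_on with
  | C a => simpa [evalAt] using a.differentiable.differentiableOn
  | add p q hp hq => simpa using hp.fun_add hq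
  | mul_X p i hp =>
    simp only [map_mul]
    refine hp.fun_mul ?_
    simpa [evalAt] using hφ i

lemma exists_eval₂Hom_mem_pow (p : MvPolynomial (Fin n) (Polynomial ℂ)) :
    ∃ e : ℕ, ∀ {A : Type} [CommRing A] [Algebra ℂ A] (W : Submodule ℂ A), 1 ≤ W → ∀ T ∈ W,
      ∀ φ : Fin n → A, (∀ k, φ k ∈ W) →
        eval₂Hom (Polynomial.aeval (R := ℂ) T).toRingHom φ p ∈ W ^ e := by
  induction p using MvPolynomial.induction_on with
  | C a =>
    refine ⟨a.natDegree, fun W hW T hT φ hφ => ?_⟩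
    have : eval₂Hom (Polynomial.aeval (R := ℂ) T).toRingHom φ (C a) = Polynomial.aeval T a := by
      simp
    rw [this, Polynomial.aeval_eq_sum_range]
    refine Submodule.sum_mem _ fun i hi => Submodule.smul_mem _ _ (pow_mem_of_le hW hT ?_)
    have := mem_range.1 hi
    omega
  | add p q hp hq =>
    obtain ⟨e, he⟩ := hp
    obtain ⟨e', he'⟩ := hq
    refine ⟨max e e', fun W hW T hT φ hφ => ?_⟩
    rw [map_add]
    exact Submodule.add_mem _ (pow_le_pow_right' hW (le_max_left _ _) (he W hW T hT φ hφ))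
      (pow_le_pow_right' hW (le_max_right _ _) (he' W hW T hT φ hφ))
  | mul_X p i hp =>
    obtain ⟨e, he⟩ := hp
    refine ⟨e + 1, fun W hW T hT φ hφ => ?_⟩
    rw [map_mul, pow_succ]
    refine Submodule.mul_mem_mul (he W hW T hT φ hφ) ?_
    simpa using hφ i

lemma eval₂Hom_aeval_apply {s : Set ℂ} (φ : Fin n → s → ℂ) (t : s)
    (p : MvPolynomial (Fin n) (Polynomial ℂ)) :
    eval₂Hom (Polynomial.aeval (R := ℂ) (fun t : s => (t : ℂ))).toRingHom φ p t =
      evalAt (t : ℂ) (fun k => φ k t) p := by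
  have : (Pi.evalRingHom (fun _ : s => ℂ) t).comp
      (eval₂Hom (Polynomial.aeval (R := ℂ) (fun t : s => (t : ℂ))).toRingHom φ) =
      evalAt (t : ℂ) (fun k => φ k t) := by
    ext <;> simp [evalAt]
  exact congrArg (fun f => f p) this

lemma evalAt_eq_eval_finSuccEquiv (t : ℂ) (x : Fin (n + 1) → ℂ)
    (p : MvPolynomial (Fin (n + 1)) (Polynomial ℂ)) :
    evalAt t x p = ((finSuccEquiv (Polynomial ℂ) n p).map (evalAt t (Fin.tail x))).eval (x 0) := by
  have : evalAt t x = ((Polynomial.evalRingHom (x 0)).comp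
      (Polynomial.mapRingHom (evalAt t (Fin.tail x)))).comp
      (finSuccEquiv (Polynomial ℂ) n : MvPolynomial (Fin (n + 1)) (Polynomial ℂ) →+* _) := by
    refine MvPolynomial.ringHom_ext (fun a => ?_) fun i => ?_
    · simp [evalAt, finSuccEquiv_apply]
    · refine Fin.cases ?_ (fun j => ?_) i <;>
      simp [evalAt, finSuccEquiv_X_zero, finSuccEquiv_X_succ, Fin.tail]
  exact congrArg (fun f => f p) this

lemma eval_eq_zero_iff_of_mul_eq {B : Set ℂ} (hBc : IsPreconnected B) {p r : ℂ → Polynomial ℂ}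
    {l : ℂ → ℂ} {d D : ℕ} {b : Fin d → ℂ → ℂ}
    (hl : ∀ t ∈ B, l t ≠ 0)
    (hpr : ∀ t ∈ B, p t * r t = Polynomial.C (l t) *
      ∏ j, (Polynomial.X - Polynomial.C (b j t)))
    (hp : ∀ k, ContinuousOn (fun t => (p t).coeff k) B)
    (hr : ∀ k, ContinuousOn (fun t => (r t).coeff k) B)
    (hpD : ∀ t ∈ B, (p t).natDegree ≤ D) (hrD : ∀ t ∈ B, (r t).natDegree ≤ D)
    (hb : ∀ j, ContinuousOn (b j) B)
    (hdich : ∀ i j, (∀ t ∈ B, b i t = b j t) ∨ ∀ t ∈ B, b i t ≠ b j t) (j : Fin d)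
    {t t₀ : ℂ} (ht : t ∈ B) (ht₀ : t₀ ∈ B) :
    (p t).eval (b j t) = 0 ↔ (p t₀).eval (b j t₀) = 0 := by
  classical
  have := isPreconnected_iff_preconnectedSpace.1 hBc
  have hprod : ∀ t, ∏ j, (Polynomial.X - Polynomial.C (b j t)) ≠ 0 := fun t =>
    Finset.prod_ne_zero_iff.2 fun j _ => Polynomial.X_sub_C_ne_zero _
  have hpr0 : ∀ t ∈ B, p t * r t ≠ 0 := fun t ht => by
    rw [hpr t ht]
    exact mul_ne_zero (by simpa using hl t ht) (hprod t)
  let f : Bool → B → Polynomial ℂ := fun i t => if i then p t else r t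
  have hf0 : ∀ i t, f i t ≠ 0 := fun i t => by
    have := hpr0 t t.2
    cases i <;> simp only [f]
    · exact right_ne_zero_of_mul this
    · exact left_ne_zero_of_mul this
  have key : ∀ (i : Bool) (t t' : B), (f i t).rootMultiplicity (b j t) =
      (f i t').rootMultiplicity (b j t') := by
    intro i t t'
    refine eq_of_isClosed_of_sum_eq (n := fun i (t : B) => (f i t).rootMultiplicity (b j t))
      (d := (univ.filter fun i => ∀ t ∈ B, b i t = b j t).card) (fun i k => ?_) (fun t => ?_) i t t'
    · refine isClosed_le_rootMultiplicity (d := D) (hf0 i) ?_ (fun k => ?_)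
        (continuousOn_iff_continuous_domRestrict.1 (hb j)) k
      · cases i <;> simp only [f]
        · exact fun t => hrD t t.2
        · exact fun t => hpD t t.2
      · cases i <;> simp only [f]
        · exact continuousOn_iff_continuous_domRestrict.1 (hr k)
        · exact continuousOn_iff_continuous_domRestrict.1 (hp k)
    · have h0 := hpr0 t t.2
      simp only [Fintype.sum_bool, f]
      simp only [if_true, if_false, Bool.false_eq_true]
      rw [← Polynomial.rootMultiplicity_mul h0, hpr t t.2, Polynomial.rootMultiplicity_mul
        (by rw [← hpr t t.2]; exact h0), Polynomial.rootMultiplicity_C, zero_add,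
        ← Polynomial.count_roots, Polynomial.roots_prod _ _ (hprod t)]
      simp only [Polynomial.roots_X_sub_C, Multiset.count_bind, Multiset.count_singleton]
      rw [card_filter]
      refine Finset.sum_congr rfl fun i _ => ?_
      rcases hdich i j with h | h
      · rw [if_pos (h t t.2).symm, if_pos h]
      · rw [if_neg (Ne.symm (h t t.2)), if_neg fun h' => h t t.2 (h' t t.2)]
  have h1 := key true ⟨t, ht⟩ ⟨t₀, ht₀⟩
  simp only [f, if_true] at h1
  have e : ∀ t ∈ B, ((p t).eval (b j t) = 0 ↔ 0 < (p t).rootMultiplicity (b j t)) := fun t ht =>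
    (Polynomial.rootMultiplicity_pos (left_ne_zero_of_mul (hpr0 t ht))).symm
  rw [e t ht, e t₀ ht₀, h1]

end FibInf

namespace FibInf
open Filter Topology Metric
variable {n : ℕ}

/-- A trivialization over the disc `ball t₀ ρ` of `ℂ × ℂⁿ`, compatible with the zero sets of all
divisors of `P`, holomorphic in the parameter, and with coordinates of controlled growth. -/
structure Trivialization (P : MvPolynomial (Fin n) (Polynomial ℂ)) (t₀ : ℂ) (ρ : ℝ) (C : ℕ)
    (Φ Φinv : ℂ → (Fin n → ℂ) → (Fin n → ℂ)) : Prop where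
  map_center : ∀ z, Φ t₀ z = z
  left_inv : ∀ t ∈ ball t₀ ρ, ∀ z, Φinv t (Φ t z) = z
  right_inv : ∀ t ∈ ball t₀ ρ, ∀ z, Φ t (Φinv t z) = z
  continuousOn : ContinuousOn (fun p : ℂ × (Fin n → ℂ) => Φ p.1 p.2) (ball t₀ ρ ×ˢ Set.univ)
  continuousOn_inv :
    ContinuousOn (fun p : ℂ × (Fin n → ℂ) => Φinv p.1 p.2) (ball t₀ ρ ×ˢ Set.univ)
  differentiableOn : ∀ z k, DifferentiableOn ℂ (fun t => Φ t z k) (ball t₀ ρ)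
  growth : ∀ z, ∃ W : Submodule ℂ (ball t₀ ρ → ℂ), HasGrowth W C ∧
    (fun t : ball t₀ ρ => (t : ℂ)) ∈ W ∧ ∀ k, (fun t : ball t₀ ρ => Φ t z k) ∈ W
  eq_zero_iff : ∀ p, p ∣ P → ∀ t ∈ ball t₀ ρ, ∀ z,
    evalAt t (Φ t z) p = 0 ↔ evalAt t₀ z p = 0

lemma exists_growth_restrict {t₀ : ℂ} {ρ r : ℝ} (hr : r ≤ ρ) {C : ℕ}
    {W : Submodule ℂ (ball t₀ ρ → ℂ)} (hW : HasGrowth W C) :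
    ∃ W' : Submodule ℂ (ball t₀ r → ℂ), HasGrowth W' C ∧
      ∀ h : ℂ → ℂ, (fun t : ball t₀ ρ => h t) ∈ W → (fun t : ball t₀ r => h t) ∈ W' := by
  let f : (ball t₀ ρ → ℂ) →ₐ[ℂ] (ball t₀ r → ℂ) :=
    { toFun := fun g t => g ⟨t, ball_subset_ball hr t.2⟩
      map_one' := rfl
      map_mul' := fun _ _ => rfl
      map_zero' := rfl
      map_add' := fun _ _ => rfl
      commutes' := fun _ => rfl }
  exact ⟨_, hW.map f, fun h hh => ⟨_, hh, rfl⟩⟩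

lemma Trivialization.restrict {P : MvPolynomial (Fin n) (Polynomial ℂ)} {t₀ : ℂ} {ρ : ℝ} {C : ℕ}
    {Φ Φinv : ℂ → (Fin n → ℂ) → (Fin n → ℂ)} (h : Trivialization P t₀ ρ C Φ Φinv) {r : ℝ}
    (hr : r ≤ ρ) : Trivialization P t₀ r C Φ Φinv where
  map_center := h.map_center
  left_inv t ht := h.left_inv t (ball_subset_ball hr ht)
  right_inv t ht := h.right_inv t (ball_subset_ball hr ht)
  continuousOn := h.continuousOn.mono (Set.prod_mono_left (ball_subset_ball hr))
  continuousOn_inv := h.continuousOn_inv.mono (Set.prod_mono_left (ball_subset_ball hr))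
  differentiableOn z k := (h.differentiableOn z k).mono (ball_subset_ball hr)
  growth z := by
    obtain ⟨W, hW, hT, hΦ⟩ := h.growth z
    obtain ⟨W', hW', hWW⟩ := exists_growth_restrict hr hW
    exact ⟨W', hW', hWW (fun t => t) hT, fun k => hWW (fun t => Φ t z k) (hΦ k)⟩
  eq_zero_iff p hp t ht := h.eq_zero_iff p hp t (ball_subset_ball hr ht)

lemma hasGrowth_span_one_self (s : Set ℂ) :
    HasGrowth (Submodule.span ℂ {1, (fun t : s => (t : ℂ))}) 1 := by
  classical
  set T : s → ℂ := fun t : s => (t : ℂ)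
  refine ⟨Submodule.subset_span (by simp), fun m => ⟨(range (m + 1)).image fun k => T ^ k,
    card_image_le.trans (by simp), ?_⟩⟩
  induction m with
  | zero =>
    rw [pow_zero, Submodule.one_le]
    exact Submodule.subset_span (by simp)
  | succ m ih =>
    rw [pow_succ]
    refine (mul_le_mul' ih le_rfl).trans ?_
    rw [Submodule.span_mul_span]
    refine Submodule.span_mono ?_
    rintro _ ⟨x, hx, y, hy, rfl⟩
    simp only [coe_image, Set.mem_image, mem_coe, mem_range] at hx ⊢
    obtain ⟨k, hk, rfl⟩ := hx
    rcases hy with rfl | rfl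
    · exact ⟨k, by omega, by simp⟩
    · exact ⟨k + 1, by omega, pow_succ _ _⟩

lemma exists_trivialization_zero (P : MvPolynomial (Fin 0) (Polynomial ℂ)) (hP : P ≠ 0) :
    ∃ c : Polynomial ℂ, c ≠ 0 ∧ ∀ t₀, c.eval t₀ ≠ 0 → ∃ ρ > 0,
      Trivialization P t₀ ρ 1 (fun _ z => z) (fun _ z => z) := by
  obtain ⟨c, rfl⟩ := C_surjective (Fin 0) P
  refine ⟨c, by rintro rfl; simp at hP, fun t₀ ht₀ => ?_⟩
  obtain ⟨ρ, hρ, hb⟩ := Metric.isOpen_iff.1 (isOpen_ne_fun c.continuous continuous_const) t₀ ht₀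
  refine ⟨ρ, hρ, fun _ => rfl, fun _ _ _ => rfl, fun _ _ _ => rfl, continuous_snd.continuousOn,
    continuous_snd.continuousOn, fun z k => differentiableOn_const _, fun z => ⟨_,
    hasGrowth_span_one_self _, Submodule.subset_span (by simp), fun k => k.elim0⟩, ?_⟩
  intro p hp t ht z
  have : ∀ t ∈ ball t₀ ρ, evalAt t z p ≠ 0 := fun t ht h => by
    have h' := map_dvd (evalAt t z) hp
    rw [h, zero_dvd_iff] at h'
    exact hb ht (by simpa [evalAt] using h')
  simp [this t ht, this t₀ (mem_ball_self hρ)]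

lemma Trivialization.exists_roots {Q : Polynomial (MvPolynomial (Fin n) (Polynomial ℂ))}
    {l : Polynomial ℂ} (hl : Q.leadingCoeff = C l) {P' : MvPolynomial (Fin n) (Polynomial ℂ)}
    (hP' : ∀ φ ψ : MvPolynomial (Fin n) (Polynomial ℂ) →+* ℂ, φ Q.leadingCoeff ≠ 0 →
      ψ Q.leadingCoeff ≠ 0 → (∀ p, p ∣ P' → (φ p = 0 ↔ ψ p = 0)) →
      (Q.map φ).roots.toFinset.card = (Q.map ψ).roots.toFinset.card)
    {t₀ : ℂ} {ρ : ℝ} {K : ℕ} {Φ Φinv : ℂ → (Fin n → ℂ) → (Fin n → ℂ)}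
    (h : Trivialization P' t₀ ρ K Φ Φinv) (hρ : 0 < ρ)
    (hlρ : ∀ t ∈ ball t₀ ρ, l.eval t ≠ 0) :
    ∃ (b : (Fin n → ℂ) → Fin Q.natDegree → ℂ → ℂ) (K' : ℕ),
      (∀ z j, DifferentiableOn ℂ (b z j) (ball t₀ ρ)) ∧
      (∀ z, ∀ t ∈ ball t₀ ρ, Polynomial.C (l.eval t)⁻¹ * Q.map (evalAt t (Φ t z)) =
        ∏ j, (Polynomial.X - Polynomial.C (b z j t))) ∧
      (∀ z i j, (∀ t ∈ ball t₀ ρ, b z i t = b z j t) ∨ ∀ t ∈ ball t₀ ρ, b z i t ≠ b z j t) ∧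
      ∀ z, ∃ W : Submodule ℂ (ball t₀ ρ → ℂ), HasGrowth W K' ∧
        (fun t : ball t₀ ρ => (t : ℂ)) ∈ W ∧ (∀ k, (fun t : ball t₀ ρ => Φ t z k) ∈ W) ∧
        ∀ j, (fun t : ball t₀ ρ => b z j t) ∈ W := by
  have hlc : ∀ t x, evalAt t x Q.leadingCoeff = l.eval t := fun t x => by simp [hl, evalAt]
  have hdeg : ∀ t ∈ ball t₀ ρ, ∀ x, (Q.map (evalAt t x)).natDegree = Q.natDegree := fun t ht x =>
    Polynomial.natDegree_map_of_leadingCoeff_ne_zero _ (by rw [hlc]; exact hlρ t ht)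
  set q : ℂ → (Fin n → ℂ) → Polynomial ℂ := fun t z =>
    Polynomial.C (l.eval t)⁻¹ * Q.map (evalAt t (Φ t z)) with hq
  have hqd : ∀ z, ∀ t ∈ ball t₀ ρ, (q t z).natDegree = Q.natDegree := fun z t ht => by
    rw [hq, Polynomial.natDegree_C_mul (inv_ne_zero (hlρ t ht)), hdeg t ht]
  have hqm : ∀ z, ∀ t ∈ ball t₀ ρ, (q t z).Monic := fun z t ht => by
    refine Polynomial.monic_C_mul_of_mul_leadingCoeff_eq_one ?_
    rw [Polynomial.leadingCoeff_map_of_leadingCoeff_ne_zero _ (by rw [hlc]; exact hlρ t ht), hlc,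
      inv_mul_cancel₀ (hlρ t ht)]
  have hqc : ∀ z t k, (q t z).coeff k = (l.eval t)⁻¹ * evalAt t (Φ t z) (Q.coeff k) :=
    fun z t k => by simp [hq]
  have hex : ∀ z, ∃ b : Fin Q.natDegree → ℂ → ℂ, (∀ j, DifferentiableOn ℂ (b j) (ball t₀ ρ)) ∧
      (∀ t ∈ ball t₀ ρ, q t z = ∏ j, (Polynomial.X - Polynomial.C (b j t))) ∧
      ∀ i j, (∀ t ∈ ball t₀ ρ, b i t = b j t) ∨ ∀ t ∈ ball t₀ ρ, b i t ≠ b j t := fun z => by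
    refine exists_holomorphic_roots hρ (q := fun t => q t z)
      (m := (Q.map (evalAt t₀ z)).roots.toFinset.card) (hqm z) (hqd z) (fun k => ?_)
      fun t ht => ?_
    · simp only [hqc]
      exact (l.differentiable.differentiableOn.fun_inv hlρ).fun_mul
        (differentiableOn_evalAt (h.differentiableOn z) _)
    · rw [hq]
      simp only
      rw [Polynomial.roots_C_mul _ (inv_ne_zero (hlρ t ht))]
      refine hP' _ _ (by rw [hlc]; exact hlρ t ht)
        (by rw [hlc]; exact hlρ t₀ (mem_ball_self hρ)) fun p hp => h.eq_zero_iff p hp t ht z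
  choose b hb hprod hdich using hex
  obtain ⟨e₀, he₀⟩ := exists_eval₂Hom_mem_pow (C l : MvPolynomial (Fin n) (Polynomial ℂ))
  choose e' he' using fun i : ℕ => exists_eval₂Hom_mem_pow (Q.coeff i)
  set e := ∑ i ∈ range Q.natDegree, e' i with he
  refine ⟨b, K * (1 + e₀) * (Q.natDegree * (1 + (1 + e))) ^ Q.natDegree, hb, hprod, hdich,
    fun z => ?_⟩
  obtain ⟨W, hW, hT, hΦ⟩ := h.growth z
  set T : ball t₀ ρ → ℂ := fun t => (t : ℂ) with hTdef
  set φ : Fin n → ball t₀ ρ → ℂ := fun k t => Φ t z k with hφ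
  obtain ⟨W₁, hWW₁, hu, hW₁⟩ := hW.adjoin_inv (u := fun t : ball t₀ ρ => (l.eval (t : ℂ))⁻¹)
    (he₀ W hW.one_le T hT φ hΦ) (by
      ext t
      rw [Pi.mul_apply, eval₂Hom_aeval_apply]
      simpa [evalAt] using inv_mul_cancel₀ (hlρ t t.2))
  obtain ⟨W₂, hW₁₂, hb₂, hW₂⟩ := hW₁.adjoin_roots (d := Q.natDegree) (e := 1 + e)
    (fun i => -((fun t : ball t₀ ρ => (l.eval (t : ℂ))⁻¹) *
      eval₂Hom (Polynomial.aeval (R := ℂ) T).toRingHom φ (Q.coeff i)))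
    (fun i hi => by
      rw [pow_add, pow_one]
      refine Submodule.neg_mem _ (Submodule.mul_mem_mul hu ?_)
      exact pow_le_pow_right' hW₁.one_le
        (Finset.single_le_sum (f := e') (fun _ _ => Nat.zero_le _) (mem_range.2 hi))
        (he' i W₁ hW₁.one_le T (hWW₁ hT) φ fun k => hWW₁ (hΦ k)))
    (fun j t => b z j t) (fun j => by
      ext t
      have h0 : (q t z).eval (b z j t) = 0 := by
        rw [hprod z t t.2, Polynomial.eval_prod]
        exact Finset.prod_eq_zero (mem_univ j) (by simp)
      rw [(hqm z t t.2).as_sum, hqd z t t.2] at h0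
      simp only [Polynomial.eval_add, Polynomial.eval_pow, Polynomial.eval_X,
        Polynomial.eval_finsetSum, Polynomial.eval_mul, Polynomial.eval_C, hqc] at h0
      simp only [Pi.pow_apply, Finset.sum_apply, Pi.mul_apply, Pi.neg_apply,
        eval₂Hom_aeval_apply, hTdef]
      rw [eq_neg_of_add_eq_zero_left h0, ← Finset.sum_neg_distrib]
      exact Finset.sum_congr rfl fun i _ => by rw [neg_mul])
  exact ⟨W₂, hW₂, hW₁₂ (hWW₁ hT), fun k => hW₁₂ (hWW₁ (hΦ k)), hb₂⟩

end FibInf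

namespace FibInf
open Filter Topology Metric

lemma exists_fiberwise_homeomorph {Z : Type*} [TopologicalSpace Z] {B : Set ℂ} {t₀ : ℂ} {d : ℕ}
    {q : ℂ → Z → Polynomial ℂ} {b : Z → Fin d → ℂ → ℂ} (hB : IsOpen B) (hBc : IsPreconnected B)
    (ht₀ : t₀ ∈ B) (hb : ∀ z j, DifferentiableOn ℂ (b z j) B)
    (hq : ∀ z, ∀ t ∈ B, q t z = ∏ j, (Polynomial.X - Polynomial.C (b z j t)))
    (hc : ∀ k, ContinuousOn (fun p : ℂ × Z => (q p.1 p.2).coeff k) (B ×ˢ Set.univ))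
    (hdich : ∀ z i j, (∀ t ∈ B, b z i t = b z j t) ∨ ∀ t ∈ B, b z i t ≠ b z j t)
    (hsep : ∀ z, ∀ t ∈ B, ∀ i j, ‖(b z i t - b z i t₀) - (b z j t - b z j t₀)‖ ≤
      1 / (4 * (d + 1) ^ 2) * ‖b z i t₀ - b z j t₀‖) :
    ∃ H G : ℂ × Z → ℂ → ℂ,
      (∀ z, ∀ t ∈ B, ∀ j, H (t, z) (b z j t₀) = b z j t) ∧ (∀ z w, H (t₀, z) w = w) ∧
      (∀ x ∈ B ×ˢ Set.univ, ∀ w, G x (H x w) = w) ∧ (∀ x ∈ B ×ˢ Set.univ, ∀ w, H x (G x w) = w) ∧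
      ContinuousOn (fun p : (ℂ × Z) × ℂ => H p.1 p.2) ((B ×ˢ Set.univ) ×ˢ Set.univ) ∧
      ContinuousOn (fun p : (ℂ × Z) × ℂ => G p.1 p.2) ((B ×ˢ Set.univ) ×ˢ Set.univ) ∧
      ∀ z w, ∃ (a : ℂ) (c : Fin d → ℂ), ∀ t, H (t, z) w = a + ∑ j, c j * b z j t := by
  have hε : (0 : ℝ) ≤ 1 / (4 * (d + 1) ^ 2) := by positivity
  let g : ℂ × Z → ℂ → ℂ := fun p w =>
    interp (fun j => b p.2 j t₀) (fun j => b p.2 j p.1 - b p.2 j t₀) w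
  have hgc : ContinuousOn (fun p : (ℂ × Z) × ℂ => g p.1 p.2)
      ((B ×ˢ Set.univ) ×ˢ Set.univ) := by
    have h1 : Continuous fun p : (ℂ × Z) × ℂ => (p.1.1, p.1.2, p.2) := by fun_prop
    have h2 := continuousOn_interp_roots hB hBc ht₀ hb hq hc hdich hε hsep
    have h3 := h2.comp (s := (B ×ˢ Set.univ) ×ˢ Set.univ) h1.continuousOn
      (fun p hp => Set.mk_mem_prod hp.1.1 (Set.mem_univ _))
    exact h3
  have hlip : ∀ p ∈ B ×ˢ (Set.univ : Set Z), ∀ w w', ‖g p w - g p w'‖ ≤ 1 / 2 * ‖w - w'‖ := by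
    intro p hp w w'
    refine (norm_interp_sub_interp_le hε (hsep p.2 p.1 hp.1) w w').trans (le_of_eq ?_)
    rw [Fintype.card_fin]
    congr 1
    field_simp
    norm_num
  obtain ⟨G, hG₁, hG₂, hGc⟩ := exists_inverse_add_contraction hgc hlip
  refine ⟨fun p w => w + g p w, G, fun z t ht j => ?_, fun z w => ?_, hG₂, hG₁,
    continuousOn_snd.add hgc, hGc, fun z w => ?_⟩
  · simp only [g]
    rw [interp_node (eq_of_norm_sub_le (hsep z t ht)) j]
    ring
  · simp [g, interp]
  · refine ⟨w - ∑ j, weight (fun j => b z j t₀) w j * b z j t₀,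
      fun j => weight (fun j => b z j t₀) w j, fun t => ?_⟩
    simp only [g, interp, mul_sub, Finset.sum_sub_distrib]
    ring

end FibInf

namespace FibInf
open Filter Topology Metric
variable {n : ℕ}

lemma Trivialization.exists_succ {P : MvPolynomial (Fin (n + 1)) (Polynomial ℂ)}
    {Q : Polynomial (MvPolynomial (Fin n) (Polynomial ℂ))}
    (hQ : finSuccEquiv (Polynomial ℂ) n P = Q) {l : Polynomial ℂ} (hl : Q.leadingCoeff = C l)
    {P' : MvPolynomial (Fin n) (Polynomial ℂ)}
    (hP' : ∀ φ ψ : MvPolynomial (Fin n) (Polynomial ℂ) →+* ℂ, φ Q.leadingCoeff ≠ 0 →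
      ψ Q.leadingCoeff ≠ 0 → (∀ p, p ∣ P' → (φ p = 0 ↔ ψ p = 0)) →
      (Q.map φ).roots.toFinset.card = (Q.map ψ).roots.toFinset.card)
    {t₀ : ℂ} {ρ : ℝ} {K : ℕ} {Φ Φinv : ℂ → (Fin n → ℂ) → (Fin n → ℂ)}
    (h : Trivialization P' t₀ ρ K Φ Φinv) (hρ : 0 < ρ)
    (hlρ : ∀ t ∈ ball t₀ ρ, l.eval t ≠ 0) :
    ∃ r > 0, ∃ K' Φ' Φinv', Trivialization P t₀ r K' Φ' Φinv' := by
  obtain ⟨b, K', hb, hprod, hdich, hgrow⟩ := h.exists_roots hl hP' hρ hlρ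
  have hε : (0 : ℝ) < 1 / (4 * (Q.natDegree + 1) ^ 2) := by positivity
  obtain ⟨r, hr, hrρ, hdist⟩ := exists_radius_distortion hρ K' hε
  have hrρ' : r ≤ ρ := by linarith
  have hsub : ball t₀ r ⊆ ball t₀ ρ := ball_subset_ball hrρ'
  have ht₀ : t₀ ∈ ball t₀ r := mem_ball_self hr
  have hsep : ∀ z, ∀ t ∈ ball t₀ r, ∀ i j, ‖(b z i t - b z i t₀) - (b z j t - b z j t₀)‖ ≤
      1 / (4 * (Q.natDegree + 1) ^ 2) * ‖b z i t₀ - b z j t₀‖ := by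
    intro z t ht i j
    rw [sub_sub_sub_comm]
    rcases hdich z i j with hij | hij
    · rw [hij t (hsub ht), hij t₀ (hsub ht₀), sub_self, sub_self, sub_self, norm_zero, mul_zero]
    · obtain ⟨W, hW, hT, -, hbW⟩ := hgrow z
      exact hdist t₀ W hW hT (fun t => b z i t - b z j t) ((hb z i).sub (hb z j))
        (Submodule.sub_mem _ (hbW i) (hbW j)) (fun t ht => sub_ne_zero.2 (hij t ht)) t ht
  have hBsub : ball t₀ r ×ˢ (Set.univ : Set (Fin n → ℂ)) ⊆ ball t₀ ρ ×ˢ Set.univ :=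
    Set.prod_mono_left hsub
  have hΦc := h.continuousOn.mono hBsub
  have hΦic := h.continuousOn_inv.mono hBsub
  have hlc : ContinuousOn (fun p : ℂ × (Fin n → ℂ) => l.eval p.1) (ball t₀ r ×ˢ Set.univ) :=
    (l.continuous.comp continuous_fst).continuousOn
  have hcoef : ∀ k, ContinuousOn (fun p : ℂ × (Fin n → ℂ) =>
      evalAt p.1 (Φ p.1 p.2) (Q.coeff k)) (ball t₀ r ×ˢ Set.univ) := fun k => by
    have h1 := (continuous_evalAt (Q.coeff k)).comp_continuousOn
      (continuous_fst.continuousOn.prodMk hΦc)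
    exact h1
  have hqc : ∀ k, ContinuousOn (fun p : ℂ × (Fin n → ℂ) =>
      (Polynomial.C (l.eval p.1)⁻¹ * Q.map (evalAt p.1 (Φ p.1 p.2))).coeff k)
      (ball t₀ r ×ˢ Set.univ) := fun k => by
    simp only [Polynomial.coeff_C_mul, Polynomial.coeff_map]
    exact (hlc.inv₀ fun p hp => hlρ _ (hsub hp.1)).mul (hcoef k)
  obtain ⟨H, G, hnode, hH₀, hGH, hHG, hHc, hGc, hHb⟩ :=
    exists_fiberwise_homeomorph (q := fun t z => Polynomial.C (l.eval t)⁻¹ *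
      Q.map (evalAt t (Φ t z))) isOpen_ball (convex_ball t₀ r).isPreconnected ht₀
      (fun z j => (hb z j).mono hsub) (fun z t ht => hprod z t (hsub ht)) hqc
      (fun z i j => (hdich z i j).imp (fun H t ht => H t (hsub ht)) fun H t ht => H t (hsub ht))
      hsep
  refine ⟨r, hr, K',
    fun t x => Fin.cons (α := fun _ => ℂ) (H (t, Fin.tail x) (x 0)) (Φ t (Fin.tail x)),
    fun t y => Fin.cons (α := fun _ => ℂ) (G (t, Φinv t (Fin.tail y)) (y 0)) (Φinv t (Fin.tail y)), ?_⟩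
  constructor
  · intro x
    simp [hH₀, h.map_center]
  · intro t ht x
    simp only [Fin.tail_cons, Fin.cons_zero, h.left_inv t (hsub ht)]
    rw [hGH _ ⟨ht, Set.mem_univ _⟩, Fin.cons_self_tail]
  · intro t ht x
    simp only [Fin.tail_cons, Fin.cons_zero, h.right_inv t (hsub ht)]
    rw [hHG _ ⟨ht, Set.mem_univ _⟩, Fin.cons_self_tail]
  · have htail : Continuous fun p : ℂ × (Fin (n + 1) → ℂ) => (p.1, Fin.tail p.2) := by
      unfold Fin.tail
      fun_prop
    refine continuousOn_pi.2 fun k => Fin.cases ?_ (fun k => ?_) k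
    · simp only [Fin.cons_zero]
      have h1 : Continuous fun p : ℂ × (Fin (n + 1) → ℂ) => ((p.1, Fin.tail p.2), p.2 0) :=
        htail.prodMk (by fun_prop)
      have h2 := hHc.comp (s := ball t₀ r ×ˢ Set.univ) h1.continuousOn
        fun p hp => Set.mk_mem_prod (Set.mk_mem_prod hp.1 (Set.mem_univ _)) (Set.mem_univ _)
      exact h2
    · simp only [Fin.cons_succ]
      exact (continuous_apply k).comp_continuousOn
        (hΦc.comp (s := ball t₀ r ×ˢ Set.univ) htail.continuousOn fun p hp => ⟨hp.1, Set.mem_univ _⟩)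
  · have htail : Continuous fun p : ℂ × (Fin (n + 1) → ℂ) => (p.1, Fin.tail p.2) := by
      unfold Fin.tail
      fun_prop
    have h1 := hΦic.comp (s := ball t₀ r ×ˢ Set.univ) htail.continuousOn fun p hp => ⟨hp.1, Set.mem_univ _⟩
    refine continuousOn_pi.2 fun k => Fin.cases ?_ (fun k => ?_) k
    · simp only [Fin.cons_zero]
      have h2 : ContinuousOn (fun p : ℂ × (Fin (n + 1) → ℂ) => p.2 0) (ball t₀ r ×ˢ Set.univ) := by
        fun_prop
      have h3 := hGc.comp (s := ball t₀ r ×ˢ Set.univ)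
        ((continuous_fst.continuousOn.prodMk h1).prodMk h2)
        fun p hp => Set.mk_mem_prod (Set.mk_mem_prod hp.1 (Set.mem_univ _)) (Set.mem_univ _)
      exact h3
    · simp only [Fin.cons_succ]
      exact (continuous_apply k).comp_continuousOn h1
  · intro x k
    refine Fin.cases ?_ (fun k => ?_) k
    · obtain ⟨a, c, hac⟩ := hHb (Fin.tail x) (x 0)
      simp only [Fin.cons_zero, hac]
      refine (differentiableOn_const _).fun_add (DifferentiableOn.fun_sum fun j _ => ?_)
      exact (differentiableOn_const _).fun_mul ((hb _ j).mono hsub)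
    · simpa only [Fin.cons_succ] using (h.differentiableOn (Fin.tail x) k).mono hsub
  · intro x
    obtain ⟨W, hW, hT, hΦW, hbW⟩ := hgrow (Fin.tail x)
    obtain ⟨W', hW', hWW⟩ := exists_growth_restrict hrρ' hW
    have hconst : ∀ a : ℂ, (fun _ : ball t₀ r => a) ∈ W' := fun a => by
      have := Submodule.smul_mem _ a hW'.1
      convert this using 1
      ext t
      simp
    refine ⟨W', hW', hWW (fun t => t) hT, fun k => ?_⟩
    refine Fin.cases ?_ (fun k => ?_) k
    · obtain ⟨a, c, hac⟩ := hHb (Fin.tail x) (x 0)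
      simp only [Fin.cons_zero, hac]
      have : ∀ j, (fun t : ball t₀ r => c j * b (Fin.tail x) j t) ∈ W' := fun j =>
        Submodule.smul_mem _ (c j) (hWW (b (Fin.tail x) j) (hbW j))
      convert Submodule.add_mem _ (hconst a) (Submodule.sum_mem _ fun j (_ : j ∈ univ) => this j)
        using 1
      ext t
      simp
    · simpa only [Fin.cons_succ] using hWW (fun t => Φ t (Fin.tail x) k) (hΦW k)
  · rintro p ⟨s, hps⟩ t ht x
    rw [evalAt_eq_eval_finSuccEquiv, evalAt_eq_eval_finSuccEquiv]
    simp only [Fin.tail_cons, Fin.cons_zero]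
    set z := Fin.tail x with hz
    set p' := finSuccEquiv (Polynomial ℂ) n p with hp'
    set s' := finSuccEquiv (Polynomial ℂ) n s with hs'
    have hps' : p' * s' = Q := by rw [← hQ, hps, map_mul]
    have hQt : ∀ t ∈ ball t₀ r, Q.map (evalAt t (Φ t z)) = Polynomial.C (l.eval t) *
        ∏ j, (Polynomial.X - Polynomial.C (b z j t)) := fun t ht => by
      rw [← hprod z t (hsub ht), ← mul_assoc, ← Polynomial.C_mul,
        mul_inv_cancel₀ (hlρ t (hsub ht)), Polynomial.C_1, one_mul]
    have hne : ∀ t ∈ ball t₀ r, ∀ y, (∀ j, y ≠ b z j t) →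
        (p'.map (evalAt t (Φ t z))).eval y ≠ 0 := fun t ht y hy h0 => by
      have h1 : (Q.map (evalAt t (Φ t z))).eval y = 0 := by
        rw [← hps', Polynomial.map_mul, Polynomial.eval_mul, h0, zero_mul]
      rw [hQt t ht, Polynomial.eval_mul, Polynomial.eval_C, Polynomial.eval_prod, mul_eq_zero,
        Finset.prod_eq_zero_iff] at h1
      rcases h1 with h1 | ⟨j, -, h1⟩
      · exact hlρ t (hsub ht) h1
      · exact hy j (sub_eq_zero.1 (by simpa using h1))
    by_cases hx : ∃ j, x 0 = b z j t₀
    · obtain ⟨j, hj⟩ := hx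
      rw [hj, hnode z t ht]
      have hcoef : ∀ (p : Polynomial (MvPolynomial (Fin n) (Polynomial ℂ))) (k : ℕ),
          ContinuousOn (fun t => (p.map (evalAt t (Φ t z))).coeff k) (ball t₀ r) := fun p k => by
        simp only [Polynomial.coeff_map]
        exact ((differentiableOn_evalAt (h.differentiableOn z) _).mono hsub).continuousOn
      have := eval_eq_zero_iff_of_mul_eq (convex_ball t₀ r).isPreconnected
        (p := fun t => p'.map (evalAt t (Φ t z))) (r := fun t => s'.map (evalAt t (Φ t z)))
        (l := fun t => l.eval t) (D := max p'.natDegree s'.natDegree) (b := b z)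
        (fun t ht => hlρ t (hsub ht))
        (fun t ht => by rw [← Polynomial.map_mul, hps', hQt t ht]) (hcoef p') (hcoef s')
        (fun t _ => Polynomial.natDegree_map_le.trans (le_max_left _ _))
        (fun t _ => Polynomial.natDegree_map_le.trans (le_max_right _ _))
        (fun j => ((hb z j).mono hsub).continuousOn)
        (fun i j => (hdich z i j).imp (fun H t ht => H t (hsub ht)) fun H t ht => H t (hsub ht))
        j ht ht₀
      simpa only [h.map_center] using this
    · push Not at hx
      have h2 := hne t₀ ht₀ (x 0) hx
      rw [h.map_center] at h2
      refine iff_of_false (hne t ht _ fun j hj => hx j ?_) h2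
      rw [← hnode z t ht] at hj
      have := congrArg (G (t, z)) hj
      rwa [hGH _ ⟨ht, Set.mem_univ _⟩, hGH _ ⟨ht, Set.mem_univ _⟩] at this

end FibInf

namespace FibInf
open Filter Topology Metric
variable {n : ℕ}

/-- The inverse of `shearPt`. -/
def unshearPt (e : Fin (n + 1) → ℕ) (x : Fin (n + 1) → ℂ) : Fin (n + 1) → ℂ :=
  fun i => if i = 0 then x 0 else x i - x 0 ^ e i

lemma shearPt_unshearPt (e : Fin (n + 1) → ℕ) (x : Fin (n + 1) → ℂ) :
    shearPt e (unshearPt e x) = x := by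
  ext i
  by_cases h : i = 0 <;> simp [shearPt, unshearPt, h]

lemma unshearPt_shearPt (e : Fin (n + 1) → ℕ) (x : Fin (n + 1) → ℂ) :
    unshearPt e (shearPt e x) = x := by
  ext i
  by_cases h : i = 0 <;> simp [shearPt, unshearPt, h]

lemma continuous_shearPt (e : Fin (n + 1) → ℕ) :
    Continuous (shearPt e : (Fin (n + 1) → ℂ) → Fin (n + 1) → ℂ) := by
  refine continuous_pi fun i => ?_
  by_cases h : i = 0 <;> simp only [shearPt, h, if_true, if_false] <;> fun_prop

lemma continuous_unshearPt (e : Fin (n + 1) → ℕ) : Continuous (unshearPt e) := by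
  refine continuous_pi fun i => ?_
  by_cases h : i = 0 <;> simp only [unshearPt, h, if_true, if_false] <;> fun_prop

lemma Trivialization.of_shear {P : MvPolynomial (Fin (n + 1)) (Polynomial ℂ)}
    {e : Fin (n + 1) → ℕ} {t₀ : ℂ} {ρ : ℝ} {K : ℕ}
    {Φ Φinv : ℂ → (Fin (n + 1) → ℂ) → (Fin (n + 1) → ℂ)}
    (h : Trivialization (shear e P) t₀ ρ K Φ Φinv) :
    Trivialization P t₀ ρ (K * (1 + ∑ i, e i)) (fun t z => shearPt e (Φ t (unshearPt e z)))
      (fun t z => shearPt e (Φinv t (unshearPt e z))) := by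
  have hc : Continuous fun p : ℂ × (Fin (n + 1) → ℂ) => (p.1, unshearPt e p.2) :=
    continuous_fst.prodMk ((continuous_unshearPt e).comp continuous_snd)
  have hm : Set.MapsTo (fun p : ℂ × (Fin (n + 1) → ℂ) => (p.1, unshearPt e p.2))
      (ball t₀ ρ ×ˢ Set.univ) (ball t₀ ρ ×ˢ Set.univ) := fun p hp => ⟨hp.1, Set.mem_univ _⟩
  have hshear : ∀ t x p, evalAt t (shearPt e x) p = evalAt t x (shear e p) := fun t x p =>
    (eval₂_shear _ e x p).symm
  constructor
  · intro z
    rw [h.map_center, shearPt_unshearPt]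
  · intro t ht z
    rw [unshearPt_shearPt, h.left_inv t ht, shearPt_unshearPt]
  · intro t ht z
    rw [unshearPt_shearPt, h.right_inv t ht, shearPt_unshearPt]
  · have h1 := (continuous_shearPt e).comp_continuousOn (h.continuousOn.comp hc.continuousOn hm)
    exact h1
  · have h1 := (continuous_shearPt e).comp_continuousOn
      (h.continuousOn_inv.comp hc.continuousOn hm)
    exact h1
  · intro z k
    by_cases hk : k = 0
    · simpa only [shearPt, hk, if_true] using h.differentiableOn _ 0
    · simpa only [shearPt, hk, if_false] using
        (h.differentiableOn _ k).fun_add ((h.differentiableOn _ 0).fun_pow (e k))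
  · intro z
    obtain ⟨W, hW, hT, hΦ⟩ := h.growth (unshearPt e z)
    have hle : W ≤ W ^ (1 + ∑ i, e i) := by
      conv_lhs => rw [← pow_one W]
      exact pow_le_pow_right' hW.one_le (by omega)
    refine ⟨_, hW.pow (by omega), hle hT, fun k => ?_⟩
    by_cases hk : k = 0
    · simpa only [shearPt, hk, if_true] using hle (hΦ 0)
    · simp only [shearPt, hk, if_false]
      refine Submodule.add_mem _ (hle (hΦ k)) (pow_mem_of_le hW.one_le (hΦ 0) ?_)
      have := Finset.single_le_sum (f := e) (fun _ _ => Nat.zero_le _) (mem_univ k)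
      omega
  · intro p hp t ht z
    rw [hshear, h.eq_zero_iff _ (map_dvd (shear e) hp) t ht, ← hshear, shearPt_unshearPt]

/-- Generic topological triviality over the affine line. -/
theorem exists_trivialization {P : MvPolynomial (Fin n) (Polynomial ℂ)} (hP : P ≠ 0) :
    ∃ c : Polynomial ℂ, c ≠ 0 ∧ ∀ t₀, c.eval t₀ ≠ 0 → ∃ ρ > 0, ∃ K Φ Φinv,
      Trivialization P t₀ ρ K Φ Φinv := by
  induction n with
  | zero =>
    obtain ⟨c, hc, h⟩ := exists_trivialization_zero P hP
    exact ⟨c, hc, fun t₀ ht₀ => by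
      obtain ⟨ρ, hρ, hT⟩ := h t₀ ht₀
      exact ⟨ρ, hρ, 1, _, _, hT⟩⟩
  | succ n ih =>
    obtain ⟨e, l, hl, hlc⟩ := exists_shear_leadingCoeff hP
    obtain ⟨P', hP'0, hP'⟩ := exists_discr_prod (finSuccEquiv (Polynomial ℂ) n (shear e P))
    obtain ⟨c, hc, h⟩ := ih hP'0
    refine ⟨c * l, mul_ne_zero hc hl, fun t₀ ht₀ => ?_⟩
    rw [Polynomial.eval_mul, mul_ne_zero_iff] at ht₀
    obtain ⟨ρ₁, hρ₁, K, Φ, Φinv, hT⟩ := h t₀ ht₀.1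
    obtain ⟨ρ₂, hρ₂, hb⟩ :=
      Metric.isOpen_iff.1 (isOpen_ne_fun l.continuous continuous_const) t₀ ht₀.2
    obtain ⟨r, hr, K', Φ', Φinv', hT'⟩ := Trivialization.exists_succ rfl hlc hP'
      (hT.restrict (min_le_left ρ₁ ρ₂)) (lt_min hρ₁ hρ₂)
      fun t ht => hb (ball_subset_ball (min_le_right _ _) ht)
    exact ⟨r, hr, _, _, _, hT'.of_shear⟩

end FibInf

namespace FibInf
open Filter Topology Metric
variable {n : ℕ}

lemma evalAt_map_C (t : ℂ) (x : Fin n → ℂ) (p : MvPolynomial (Fin n) ℂ) :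
    evalAt t x (map Polynomial.C p) = eval x p := by
  simp only [evalAt, coe_eval₂Hom, eval₂_map]
  have : (Polynomial.evalRingHom t).comp Polynomial.C = RingHom.id ℂ := by
    ext
    simp
  rw [this]
  rfl

lemma evalAt_map_C_sub (t : ℂ) (x : Fin n → ℂ) (F : MvPolynomial (Fin n) ℂ) :
    evalAt t x (map Polynomial.C F - C Polynomial.X) = eval x F - t := by
  rw [map_sub, evalAt_map_C]
  simp [evalAt]

lemma isPreconnected_lt_norm {R : ℝ} (hR : 0 < R) : IsPreconnected {z : ℂ | R < ‖z‖} := by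
  have : {z : ℂ | R < ‖z‖} = Complex.exp '' {w | Real.log R < w.re} := by
    ext z
    constructor
    · intro hz
      have hz0 : z ≠ 0 := norm_pos_iff.1 (hR.trans hz)
      exact ⟨Complex.log z, by
        rw [Set.mem_ofPred_eq, Complex.log_re]
        exact Real.log_lt_log hR hz, Complex.exp_log hz0⟩
    · rintro ⟨w, hw, rfl⟩
      rw [Set.mem_ofPred_eq, Complex.norm_exp]
      exact (Real.log_lt_iff_lt_exp hR).1 hw
  rw [this]
  exact (convex_halfSpace_re_gt _).isPreconnected.image _ Complex.continuous_exp.continuousOn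

lemma exists_radius_eval_ne_zero {c : Polynomial ℂ} (hc : c ≠ 0) :
    ∃ R : ℝ, 0 < R ∧ ∀ t : ℂ, R < ‖t‖ → c.eval t ≠ 0 := by
  refine ⟨1 + ∑ z ∈ c.roots.toFinset, ‖z‖, by positivity, fun t ht h0 => ?_⟩
  have hmem : t ∈ c.roots.toFinset := by
    simpa [hc] using h0
  have := Finset.single_le_sum (f := fun z : ℂ => ‖z‖) (fun _ _ => norm_nonneg _) hmem
  linarith

variable {S : Finset (MvPolynomial (Fin n) ℂ)} {F : MvPolynomial (Fin n) ℂ}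

variable (S F) in
/-- A polynomial divisible by all nonzero elements of `S`, and by `F - t`. -/
def totalPoly : MvPolynomial (Fin n) (Polynomial ℂ) :=
  (∏ p ∈ S, open Classical in if p = 0 then 1 else map Polynomial.C p) *
    (map Polynomial.C F - C Polynomial.X)

lemma totalPoly_ne_zero : totalPoly S F ≠ 0 := by
  refine mul_ne_zero (Finset.prod_ne_zero_iff.2 fun p _ => ?_) fun h => ?_
  · split_ifs with hp
    · exact one_ne_zero
    · exact fun h => hp (map_injective _ Polynomial.C_injective (h.trans (map_zero _).symm))
  · have := evalAt_map_C_sub (eval 0 F + 1) 0 F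
    rw [h, map_zero] at this
    simp at this

lemma map_C_dvd_totalPoly {p : MvPolynomial (Fin n) ℂ} (hp : p ∈ S) (h0 : p ≠ 0) :
    map Polynomial.C p ∣ totalPoly S F := by
  classical
  refine Dvd.dvd.mul_right ?_ _
  have := Finset.dvd_prod_of_mem (fun p : MvPolynomial (Fin n) ℂ =>
    open Classical in if p = 0 then 1 else map (Polynomial.C : ℂ →+* Polynomial ℂ) p) hp
  simpa [h0] using this

variable {t₀ : ℂ} {ρ : ℝ} {K : ℕ} {Φ Φinv : ℂ → (Fin n → ℂ) → (Fin n → ℂ)}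
  {U : Set (Fin n → ℂ)}

lemma Trivialization.apply_mem_iff
    (h : Trivialization (totalPoly S F) t₀ ρ K Φ Φinv) (hU : U = {x | ∀ p ∈ S, eval x p = 0})
    {t : ℂ} (ht : t ∈ ball t₀ ρ) (z : Fin n → ℂ) :
    (Φ t z ∈ U ∧ eval (Φ t z) F = t) ↔ (z ∈ U ∧ eval z F = t₀) := by
  have hF := h.eq_zero_iff _ (dvd_mul_left _ _) t ht z
  rw [evalAt_map_C_sub, evalAt_map_C_sub, sub_eq_zero, sub_eq_zero] at hF
  refine and_congr ?_ hF
  rw [hU]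
  refine forall₂_congr fun p hp => ?_
  by_cases h0 : p = 0
  · simp [h0]
  · have := h.eq_zero_iff _ (map_C_dvd_totalPoly hp h0) t ht z
    rwa [evalAt_map_C, evalAt_map_C] at this

lemma Trivialization.inv_apply_mem_iff
    (h : Trivialization (totalPoly S F) t₀ ρ K Φ Φinv) (hU : U = {x | ∀ p ∈ S, eval x p = 0})
    {t : ℂ} (ht : t ∈ ball t₀ ρ) (x : Fin n → ℂ) :
    (Φinv t x ∈ U ∧ eval (Φinv t x) F = t₀) ↔ (x ∈ U ∧ eval x F = t) := by
  rw [← h.apply_mem_iff hU ht, h.right_inv t ht]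

/-- The local trivialization of `F` on the zero set of `S` over a disc. -/
def Trivialization.homeomorph
    (h : Trivialization (totalPoly S F) t₀ ρ K Φ Φinv) (hU : U = {x | ∀ p ∈ S, eval x p = 0}) :
    {x : Fin n → ℂ // x ∈ U ∧ eval x F ∈ ball t₀ ρ} ≃ₜ
      (ball t₀ ρ × {x : Fin n → ℂ // x ∈ U ∧ eval x F = t₀}) where
  toFun x := (⟨eval x.1 F, x.2.2⟩,
    ⟨Φinv (eval x.1 F) x.1, (h.inv_apply_mem_iff hU x.2.2 x.1).2 ⟨x.2.1, rfl⟩⟩)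
  invFun y := ⟨Φ y.1 y.2, by
    have hy := (h.apply_mem_iff hU y.1.2 y.2.1).2 y.2.2
    exact ⟨hy.1, by rw [hy.2]; exact y.1.2⟩⟩
  left_inv x := Subtype.ext (h.right_inv _ x.2.2 x.1)
  right_inv y := by
    have hy := ((h.apply_mem_iff hU y.1.2 y.2.1).2 y.2.2).2
    refine Prod.ext (Subtype.ext hy) (Subtype.ext ?_)
    simp only [hy]
    exact h.left_inv _ y.1.2 _
  continuous_toFun := by
    have h1 : Continuous fun x : {x : Fin n → ℂ // x ∈ U ∧ eval x F ∈ ball t₀ ρ} =>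
        eval x.1 F := (MvPolynomial.continuous_eval F).comp continuous_subtype_val
    refine (h1.subtype_mk _).prodMk (Continuous.subtype_mk ?_ _)
    exact h.continuousOn_inv.comp_continuous (h1.prodMk continuous_subtype_val)
      fun x => ⟨x.2.2, Set.mem_univ _⟩
  continuous_invFun := by
    refine Continuous.subtype_mk ?_ _
    exact h.continuousOn.comp_continuous
      (f := fun y : ball t₀ ρ × {x : Fin n → ℂ // x ∈ U ∧ eval x F = t₀} => (y.1.1, y.2.1))
      (by fun_prop) fun y => ⟨y.1.2, Set.mem_univ _⟩

/-- The fibre over a point of the disc is homeomorphic to the central fibre. -/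
def Trivialization.fiberHomeomorph
    (h : Trivialization (totalPoly S F) t₀ ρ K Φ Φinv) (hU : U = {x | ∀ p ∈ S, eval x p = 0})
    {t : ℂ} (ht : t ∈ ball t₀ ρ) :
    {x : Fin n → ℂ // x ∈ U ∧ eval x F = t₀} ≃ₜ {x : Fin n → ℂ // x ∈ U ∧ eval x F = t} where
  toFun z := ⟨Φ t z, (h.apply_mem_iff hU ht z).2 z.2⟩
  invFun x := ⟨Φinv t x, (h.inv_apply_mem_iff hU ht x).2 x.2⟩
  left_inv z := Subtype.ext (h.left_inv t ht z)
  right_inv x := Subtype.ext (h.right_inv t ht x)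
  continuous_toFun := Continuous.subtype_mk (h.continuousOn.comp_continuous
    (f := fun z : {x : Fin n → ℂ // x ∈ U ∧ eval x F = t₀} => (t, z.1))
    (by fun_prop) fun _ => ⟨ht, Set.mem_univ _⟩) _
  continuous_invFun := Continuous.subtype_mk (h.continuousOn_inv.comp_continuous
    (f := fun x : {x : Fin n → ℂ // x ∈ U ∧ eval x F = t} => (t, x.1))
    (by fun_prop) fun _ => ⟨ht, Set.mem_univ _⟩) _

end FibInf

/-- Fibration theorem at infinity (Pham/Verdier).  Let `U ⊆ ℂ^N` be a smooth affine
complex variety (the common zero set of a finite set `S` of polynomials whose Jacobian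
has constant rank on `U`) and `f : U → 𝔸¹` a non-constant regular map (restriction of a
polynomial `F`).  Then there is `R > 0` such that
`f : U \ f⁻¹(D̄(0,R)) → ℂ \ D̄(0,R)` is a locally trivial topological fibration;
in particular all fibers `f⁻¹(t)`, `|t| > R`, are homeomorphic. -/
theorem fibration_at_infinity {N : ℕ} (S : Finset (MvPolynomial (Fin N) ℂ))
    (U : Set (Fin N → ℂ)) (hU : U = {x | ∀ p ∈ S, eval x p = 0})
    (hsmooth : ∃ c : ℕ, ∀ x ∈ U,
      Module.finrank ℂ (Submodule.span ℂ ((fun p => gradAt p x) '' (S : Set _))) = c)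
    (F : MvPolynomial (Fin N) ℂ)
    (hnonconst : ¬ ∀ x ∈ U, ∀ y ∈ U, eval x F = eval y F) :
    ∃ R : ℝ, 0 < R ∧
      (∀ t : ℂ, R < ‖t‖ → ∃ V : Set ℂ, IsOpen V ∧ t ∈ V ∧ V ⊆ {z : ℂ | R < ‖z‖} ∧
        ∃ h : {x : Fin N → ℂ // x ∈ U ∧ eval x F ∈ V} ≃ₜ
            (V × {x : Fin N → ℂ // x ∈ U ∧ eval x F = t}),
          ∀ u, ((h u).1 : ℂ) = eval (u : {x : Fin N → ℂ // x ∈ U ∧ eval x F ∈ V}).1 F) ∧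
      (∀ t s : ℂ, R < ‖t‖ → R < ‖s‖ →
        Nonempty ({x : Fin N → ℂ // x ∈ U ∧ eval x F = t} ≃ₜ
          {x : Fin N → ℂ // x ∈ U ∧ eval x F = s})) := by
  obtain ⟨c, hc, hT⟩ := FibInf.exists_trivialization (FibInf.totalPoly_ne_zero (S := S) (F := F))
  obtain ⟨R, hR, hcR⟩ := FibInf.exists_radius_eval_ne_zero hc
  refine ⟨R, hR, fun t ht => ?_, fun t s ht hs => ?_⟩
  · obtain ⟨ρ, hρ, K, Φ, Φinv, h⟩ := hT t (hcR t ht)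
    refine ⟨Metric.ball t (min ρ (‖t‖ - R)), Metric.isOpen_ball,
      Metric.mem_ball_self (lt_min hρ (sub_pos.2 ht)), fun z hz => ?_,
      (h.restrict (min_le_left _ _)).homeomorph hU, fun u => rfl⟩
    have h1 : ‖t - z‖ < ‖t‖ - R := by
      rw [norm_sub_rev, ← dist_eq_norm]
      exact (Metric.mem_ball.1 hz).trans_le (min_le_right _ _)
    have h2 := norm_sub_norm_le t z
    rw [Set.mem_ofPred_eq]
    linarith
  · refine (FibInf.isPreconnected_lt_norm hR).induction₂' (fun t s =>
      Nonempty ({x : Fin N → ℂ // x ∈ U ∧ eval x F = t} ≃ₜ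
        {x : Fin N → ℂ // x ∈ U ∧ eval x F = s})) (fun t ht => ?_)
      (fun _ _ _ _ _ _ ⟨e⟩ ⟨e'⟩ => ⟨e.trans e'⟩) ht hs
    obtain ⟨ρ, hρ, K, Φ, Φinv, h⟩ := hT t (hcR t ht)
    filter_upwards [mem_nhdsWithin_of_mem_nhds (Metric.ball_mem_nhds t hρ)] with s hs
    exact ⟨⟨h.fiberHomeomorph hU hs⟩, ⟨(h.fiberHomeomorph hU hs).symm⟩⟩
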